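/- arXiv:1610.04357 — 2 statements merged into one kernel-verified Lean document; each statement's English description precedes it below -/
import Mathlib

section
/- For the biased birth-and-death chain of Example 3.3, there exist absolute constants c, C > 0 such that for every δ ∈ (0,1/2) and all sufficiently large n: c·√δ·n ≤ t_δ − 2·τ_δ ≤ C·√δ·n (in particular 2τ_δ < t_δ for all sufficiently large n). -/
open Filter Finset

noncomputable section

variable {V : Type} [Fintype V] [DecidableEq V]

/-- `P` is a row-stochastic matrix. -/
def IsStoch (P : Matrix V V ℝ) : Prop :=
  (∀ i j, 0 ≤ P i j) ∧ ∀ i, ∑ j, P i j = 1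

/-- `π` is a probability vector with full support. -/
def IsProb (π : V → ℝ) : Prop := (∀ i, 0 < π i) ∧ ∑ i, π i = 1

/-- reversibility: `π x * P x y = π y * P y x`. -/
def Rev (P : Matrix V V ℝ) (π : V → ℝ) : Prop := ∀ i j, π i * P i j = π j * P j i

/-- irreducibility -/
def Irred (P : Matrix V V ℝ) : Prop := ∀ i j, ∃ t : ℕ, 0 < (P ^ t) i j

/-- the lazy version `(I + P)/2` of a chain -/
def lazyM (P : Matrix V V ℝ) : Matrix V V ℝ := (2 : ℝ)⁻¹ • (1 + P)

/-- total variation distance -/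
def tvDist (μ ν : V → ℝ) : ℝ := (∑ x, |μ x - ν x|) / 2

/-- worst-case total variation distance from stationarity at time `t` -/
def dTV (P : Matrix V V ℝ) (π : V → ℝ) (t : ℕ) : ℝ := ⨆ x, tvDist ((P ^ t) x) π

/-- the `ε` total-variation mixing time -/
def mixTime (P : Matrix V V ℝ) (π : V → ℝ) (ε : ℝ) : ℕ := sInf {t : ℕ | dTV P π t ≤ ε}

/-- worst-case separation distance at time `t` -/
def dSep (P : Matrix V V ℝ) (π : V → ℝ) (t : ℕ) : ℝ := 1 - ⨅ x, ⨅ y, ((P ^ t) x y) / π y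

/-- the `ε` separation time -/
def sepTime (P : Matrix V V ℝ) (π : V → ℝ) (ε : ℝ) : ℕ := sInf {t : ℕ | dSep P π t ≤ ε}

/-- the heat kernel `H_t = exp (t (P - I))` of the associated continuous-time chain -/
def heatKer (P : Matrix V V ℝ) (t : ℝ) : Matrix V V ℝ :=
  ∑' k : ℕ, (t ^ k / (Nat.factorial k : ℝ)) • ((P - 1) ^ k)

/-- separation distance of the continuous-time chain -/
def dSepC (P : Matrix V V ℝ) (π : V → ℝ) (t : ℝ) : ℝ := 1 - ⨅ x, ⨅ y, (heatKer P t) x y / π y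

/-- the `ε` separation time of the continuous-time chain -/
def sepTimeC (P : Matrix V V ℝ) (π : V → ℝ) (ε : ℝ) : ℝ := sInf {t : ℝ | 0 ≤ t ∧ dSepC P π t ≤ ε}

/-- degree of a vertex -/
def deg (G : SimpleGraph V) (v : V) : ℕ := Nat.card {u // G.Adj v u}

open Classical in
/-- transition matrix of the lazy simple random walk on `G` -/
def walkMat (G : SimpleGraph V) : Matrix V V ℝ :=
  Matrix.of fun v u => if v = u then 1/2 else if G.Adj v u then 1 / (2 * (deg G v : ℝ)) else 0

/-- stationary distribution of the (lazy) simple random walk on `G` -/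
def degSta (G : SimpleGraph V) (v : V) : ℝ := (deg G v : ℝ) / ∑ u, (deg G u : ℝ)

/-- the `ε` total-variation mixing time of the lazy simple random walk on `G` -/
def tmixG (G : SimpleGraph V) (ε : ℝ) : ℕ := mixTime (walkMat G) (degSta G) ε

/-- the second largest eigenvalue of a reversible transition matrix -/
def lam2 (P : Matrix V V ℝ) : ℝ :=
  sSup {μ : ℝ | μ ≠ 1 ∧ ∃ f : V → ℝ, f ≠ 0 ∧ P.mulVec f = μ • f}

/-- the relaxation time `1/(1-λ₂)` -/
def trel (P : Matrix V V ℝ) : ℝ := 1 / (1 - lam2 P)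

/-- the relaxation time of the lazy simple random walk on `G` -/
def trelG (G : SimpleGraph V) : ℝ := trel (walkMat G)

/-- transition matrix of the lazy random walk on the network with edge weights `w` -/
def wMat (w : V → V → ℝ) : Matrix V V ℝ :=
  Matrix.of fun v u => if v = u then 1/2 else w v u / (2 * ∑ x, w v x)

/-- stationary distribution of the lazy random walk on the network with edge weights `w` -/
def wSta (w : V → V → ℝ) (v : V) : ℝ := (∑ x, w v x) / ∑ u, ∑ x, w u x

/-- `w` is a valid system of edge weights on the graph `G`: symmetric, positive on edges
and vanishing off the edges. -/
def GoodWeights (G : SimpleGraph V) (w : V → V → ℝ) : Prop :=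
  (∀ u v, w u v = w v u) ∧ (∀ u v, G.Adj u v → 0 < w u v) ∧ ∀ u v, ¬ G.Adj u v → w u v = 0

/-- the `ε` total-variation mixing time of the lazy random walk on the weighted network -/
def tmixW (w : V → V → ℝ) (ε : ℝ) : ℕ := mixTime (wMat w) (wSta w) ε

/-- the probability of a discrete trajectory -/
def pathProb (P : Matrix V V ℝ) {k : ℕ} (w : Fin (k+1) → V) : ℝ :=
  ∏ i : Fin k, P (w i.castSucc) (w i.succ)

/-- `P_x[T_y = k]`: probability that the chain started at `x` first hits `y` at time `k` -/
def firstHit (P : Matrix V V ℝ) (x y : V) (k : ℕ) : ℝ :=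
  ∑ w : Fin (k+1) → V,
    if w 0 = x ∧ w (Fin.last k) = y ∧ ∀ i : Fin k, w i.castSucc ≠ y then pathProb P w else 0

/-- the restriction of `P - I` to the complement of `y` -/
def restrQ (P : Matrix V V ℝ) (y : V) : Matrix {w : V // w ≠ y} {w : V // w ≠ y} ℝ :=
  Matrix.of fun a b => P a.1 b.1 - if a = b then 1 else 0

/-- `exp (t A)` where `A` is the restriction of `P - I` to the complement of `y` -/
def heatRestr (P : Matrix V V ℝ) (y : V) (t : ℝ) :
    Matrix {w : V // w ≠ y} {w : V // w ≠ y} ℝ :=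
  ∑' k : ℕ, (t ^ k / (Nat.factorial k : ℝ)) • (restrQ P y ^ k)

/-- `P_x[T_B < r]` for the chain `P`: the probability that the set `B` is hit before time `r` -/
def hitByTime (P : Matrix V V ℝ) (B : Finset V) (x : V) (r : ℕ) : ℝ :=
  ∑ k ∈ Finset.range r, ∑ w : Fin (k+1) → V,
    if w 0 = x ∧ w (Fin.last k) ∈ B ∧ ∀ i : Fin k, w i.castSucc ∉ B then pathProb P w else 0


/-! ### The biased birth-and-death chain of Example 3.3 -/

/-- the neighbor of state `m` in the direction of `z`
(states `0 = z`, `1, …, n` is the `a`-branch, `n+1, …, 2n` is the `b`-branch). -/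
def exDown (n m : ℕ) : ℕ := if m = n + 1 then 0 else m - 1

/-- the transition matrix of the chain of Example 3.3: a birth and death chain on
`{a_n, …, a_1, z, b_1, …, b_n}` with a fixed bias `2/3` towards the middle state `z`. -/
def exP (n : ℕ) : Matrix (Fin (2*n+1)) (Fin (2*n+1)) ℝ :=
  Matrix.of fun i j =>
    if i.val = 0 then (if j.val = 1 ∨ j.val = n + 1 then 1/2 else 0)
    else if i.val = n ∨ i.val = 2*n then (if j.val = exDown n i.val then 1 else 0)
    else if j.val = exDown n i.val then 2/3
    else if j.val = i.val + 1 then 1/3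
    else 0

/-- the state `z` -/
def exZ (n : ℕ) : Fin (2*n+1) := ⟨0, by omega⟩
/-- the state `a = a_n` -/
def exA (n : ℕ) : Fin (2*n+1) := ⟨n, by omega⟩
/-- the state `b = b_n` -/
def exB (n : ℕ) : Fin (2*n+1) := ⟨2*n, by omega⟩

/-- `P[T_z^{a,b} ≤ t]`: the distribution function of the sum of the hitting times of `z` of
two independent lazy chains started at `a` and at `b`. -/
def exCDFd (n : ℕ) (t : ℕ) : ℝ :=
  ∑ k ∈ Finset.range (t+1), ∑ j ∈ Finset.range (t+1-k),
    firstHit (lazyM (exP n)) (exA n) (exZ n) k * firstHit (lazyM (exP n)) (exB n) (exZ n) j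

/-- `t_δ = min {t : P[T_z^{a,b} ≤ t] ≥ 2^{-δn}}` -/
def tdelta (n : ℕ) (δ : ℝ) : ℕ :=
  sInf {t : ℕ | (2 : ℝ) ^ (-(δ * n)) ≤ exCDFd n t}

/-- `P[τ_z > t]` for the continuous-time chain started at `x`:
`Σ_{w ≠ z} [exp(tA)]_{x,w}` where `A` is the restriction of `P - I` to the complement of `z`. -/
def exSurv (n : ℕ) (x : Fin (2*n+1)) (t : ℝ) : ℝ :=
  if h : x = exZ n then 0
  else ∑ w : {w : Fin (2*n+1) // w ≠ exZ n}, heatRestr (exP n) (exZ n) t ⟨x, h⟩ w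

/-- the density of the hitting time of `z` for the continuous-time chain started at `x`:
`f(s) = Σ_{w ≠ z} [exp(sA)]_{x,w} P(w,z)`. -/
def exDens (n : ℕ) (x : Fin (2*n+1)) (s : ℝ) : ℝ :=
  if h : x = exZ n then 0
  else ∑ w : {w : Fin (2*n+1) // w ≠ exZ n},
    heatRestr (exP n) (exZ n) s ⟨x, h⟩ w * exP n w.1 (exZ n)

/-- `P[τ_z^{a,b} ≤ t]`: the distribution function of the sum of the hitting times of `z` of
two independent continuous-time chains started at `a` and at `b`. -/
def exCDFc (n : ℕ) (t : ℝ) : ℝ :=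
  ∫ s in (0:ℝ)..t, exDens n (exA n) s * (1 - exSurv n (exB n) (t - s))

/-- `τ_δ = inf {t ≥ 0 : P[τ_z^{a,b} ≤ t] ≥ 2^{-δn}}` -/
def taudelta (n : ℕ) (δ : ℝ) : ℝ :=
  sInf {t : ℝ | 0 ≤ t ∧ (2 : ℝ) ^ (-(δ * n)) ≤ exCDFc n t}

/-! ### First hitting times of a finite chain -/

theorem firstHit_zero (P : Matrix V V ℝ) (x y : V) :
    firstHit P x y 0 = if x = y then 1 else 0 := by
  unfold firstHit
  rw [Fintype.sum_equiv (Equiv.funUnique (Fin 1) V) _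
    (fun v : V => if v = x ∧ v = y then (1 : ℝ) else 0)]
  · by_cases h : x = y
    · subst h; simp
    · simp only [h, if_false]
      refine Finset.sum_eq_zero fun v _ => ?_
      rw [if_neg]
      rintro ⟨rfl, rfl⟩
      exact h rfl
  · intro w
    simp [pathProb, Equiv.funUnique]

theorem firstHit_succ (P : Matrix V V ℝ) (x y : V) (k : ℕ) :
    firstHit P x y (k + 1) = if x = y then 0 else ∑ v, P x v * firstHit P v y k := by
  unfold firstHit
  rw [← Fintype.sum_equiv (Fin.consEquiv (fun _ : Fin (k + 2) => V))
    (fun p : V × (Fin (k + 1) → V) => if p.1 = x ∧ p.2 (Fin.last k) = y ∧ p.1 ≠ y ∧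
      ∀ i : Fin k, p.2 i.castSucc ≠ y then P p.1 (p.2 0) * pathProb P p.2 else 0) _]
  · rw [Fintype.sum_prod_type]
    rw [Finset.sum_eq_single x]
    · by_cases h : x = y
      · simp [h]
      · simp only [h, if_false, true_and, ne_eq, not_false_eq_true, Finset.mul_sum]
        rw [Finset.sum_comm]
        refine Finset.sum_congr rfl fun w _ => ?_
        rw [Finset.sum_eq_single (w 0)]
        · by_cases hw : w (Fin.last k) = y ∧ ∀ i : Fin k, ¬w i.castSucc = y
          · simp [hw]
          · simp [hw]
        · intro b _ hb
          rw [if_neg, mul_zero]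
          exact fun h => hb h.1.symm
        · simp
    · intro b _ hb
      refine Finset.sum_eq_zero fun w _ => ?_
      rw [if_neg]
      exact fun h => hb h.1
    · simp
  · rintro ⟨v, w⟩
    simp only [Fin.consEquiv, Equiv.coe_fn_mk, pathProb, Fin.prod_univ_succ, Fin.cons_zero,
      Fin.castSucc_zero, Fin.cons_succ, Fin.forall_fin_succ, ← Fin.succ_last,
      ← Fin.succ_castSucc]

theorem firstHit_nonneg {P : Matrix V V ℝ} (hP : ∀ i j, 0 ≤ P i j) (x y : V) (k : ℕ) :
    0 ≤ firstHit P x y k := by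
  unfold firstHit
  refine Finset.sum_nonneg fun w _ => ?_
  split_ifs
  · exact Finset.prod_nonneg fun i _ => hP _ _
  · exact le_rfl

theorem sum_pow_mul_firstHit_succ (P : Matrix V V ℝ) (x y : V) (s : ℝ) (N : ℕ) :
    ∑ k ∈ range (N + 1), s ^ k * firstHit P x y k =
      if x = y then 1 else s * ∑ v, P x v * ∑ k ∈ range N, s ^ k * firstHit P v y k := by
  rw [Finset.sum_range_succ']
  by_cases h : x = y
  · simp [h, firstHit_zero, firstHit_succ]
  · simp only [firstHit_succ, firstHit_zero, h, if_false, mul_zero, add_zero, Finset.mul_sum]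
    rw [Finset.sum_comm]
    refine Finset.sum_congr rfl fun v _ => Finset.sum_congr rfl fun k _ => ?_
    ring

theorem sum_pow_mul_firstHit_le {P : Matrix V V ℝ} (hP : ∀ i j, 0 ≤ P i j) {y : V} {s : ℝ}
    (hs : 0 ≤ s) {h : V → ℝ} (h0 : ∀ x, 0 ≤ h x) (hy : 1 ≤ h y)
    (hsup : ∀ x, x ≠ y → s * ∑ v, P x v * h v ≤ h x) (N : ℕ) (x : V) :
    ∑ k ∈ range N, s ^ k * firstHit P x y k ≤ h x := by
  induction N generalizing x with
  | zero => simpa using h0 x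
  | succ N ih =>
    rw [sum_pow_mul_firstHit_succ]
    split_ifs with hxy
    · exact hxy ▸ hy
    · refine le_trans ?_ (hsup x hxy)
      gcongr with v _
      · exact hP x v
      · exact ih v

theorem sub_pow_le_sum_pow_mul_firstHit {P : Matrix V V ℝ} (hP : ∀ i j, 0 ≤ P i j) {y : V}
    (hP1 : ∀ x, x ≠ y → ∑ v, P x v = 1) {s : ℝ} (hs : 0 ≤ s) {h : V → ℝ} (h1 : ∀ x, h x ≤ 1)
    (hsub : ∀ x, x ≠ y → h x ≤ s * ∑ v, P x v * h v) (N : ℕ) (x : V) :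
    h x - s ^ N ≤ ∑ k ∈ range N, s ^ k * firstHit P x y k := by
  induction N generalizing x with
  | zero => simpa using h1 x
  | succ N ih =>
    rw [sum_pow_mul_firstHit_succ]
    split_ifs with hxy
    · have := h1 x
      have : 0 ≤ s ^ (N + 1) := by positivity
      linarith
    · calc h x - s ^ (N + 1) ≤ s * ∑ v, P x v * h v - s ^ (N + 1) := by
            have := hsub x hxy
            linarith
        _ = s * ∑ v, P x v * (h v - s ^ N) := by
            simp only [mul_sub, Finset.sum_sub_distrib, ← Finset.sum_mul, hP1 x hxy]
            ring
        _ ≤ _ := by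
            gcongr with v _
            · exact hP x v
            · exact ih v

/-- Chernoff bound for the lower tail of the sum of two independent discrete times. -/
theorem sum_convolution_mul_pow_le {f g : ℕ → ℝ} (hf : ∀ k, 0 ≤ f k) (hg : ∀ k, 0 ≤ g k)
    {s F G : ℝ} (hs : 0 ≤ s) (hs1 : s ≤ 1) (hF : ∀ N, ∑ k ∈ range N, s ^ k * f k ≤ F)
    (hG : ∀ N, ∑ k ∈ range N, s ^ k * g k ≤ G) (t : ℕ) :
    (∑ k ∈ range (t + 1), ∑ j ∈ range (t + 1 - k), f k * g j) * s ^ t ≤ F * G := by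
  calc (∑ k ∈ range (t + 1), ∑ j ∈ range (t + 1 - k), f k * g j) * s ^ t
      ≤ ∑ k ∈ range (t + 1), ∑ j ∈ range (t + 1 - k), (s ^ k * f k) * (s ^ j * g j) := by
        simp only [Finset.sum_mul]
        refine Finset.sum_le_sum fun k hk => Finset.sum_le_sum fun j hj => ?_
        rw [Finset.mem_range] at hk hj
        have : s ^ t ≤ s ^ k * s ^ j := by
          rw [← pow_add]
          exact pow_le_pow_of_le_one hs hs1 (by omega)
        have h2 := mul_le_mul_of_nonneg_left this (mul_nonneg (hf k) (hg j))
        nlinarith [h2]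
    _ ≤ ∑ k ∈ range (t + 1), (s ^ k * f k) * G := by
        refine Finset.sum_le_sum fun k _ => ?_
        rw [← Finset.mul_sum]
        exact mul_le_mul_of_nonneg_left (hG _) (mul_nonneg (pow_nonneg hs k) (hf k))
    _ ≤ F * G := by
        rw [← Finset.sum_mul]
        exact mul_le_mul_of_nonneg_right (hF _) (by simpa using hG 0)

/-- A lower bound on the lower tail of the sum of two independent discrete times in terms of
the generating functions. -/
theorem mul_le_sum_convolution_add_pow {f g : ℕ → ℝ} (hf : ∀ k, 0 ≤ f k) (hg : ∀ k, 0 ≤ g k)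
    {s F G : ℝ} (hs : 0 ≤ s) (hs1 : s < 1) (hF0 : 0 < F) (hG0 : 0 < G)
    (hf1 : ∀ N, ∑ k ∈ range N, f k ≤ 1) (hg1 : ∀ N, ∑ k ∈ range N, g k ≤ 1)
    (hF : ∀ N, F - s ^ N ≤ ∑ k ∈ range N, s ^ k * f k)
    (hG : ∀ N, G - s ^ N ≤ ∑ k ∈ range N, s ^ k * g k) (t : ℕ) :
    F * G ≤ (∑ k ∈ range (t + 1), ∑ j ∈ range (t + 1 - k), f k * g j) + s ^ t := by
  have hlim := tendsto_pow_atTop_nhds_zero_of_lt_one hs hs1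
  have hlimF : Tendsto (fun N : ℕ => F - s ^ N) atTop (nhds F) := by
    simpa using hlim.const_sub F
  have hlimG : Tendsto (fun N : ℕ => G - s ^ N) atTop (nhds G) := by
    simpa using hlim.const_sub G
  refine le_of_tendsto (hlimF.mul hlimG) ?_
  filter_upwards [hlimF.eventually (lt_mem_nhds hF0), hlimG.eventually (lt_mem_nhds hG0),
    eventually_ge_atTop (t + 1)] with N hN1 hN2 hN
  have hsplit : ∀ k, ∑ j ∈ range N, (s ^ k * f k) * (s ^ j * g j) ≤
      (∑ j ∈ range (t + 1 - k), f k * g j) + s ^ t * f k := by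
    intro k
    have hle : t + 1 - k ≤ N := by omega
    rw [← Finset.sum_range_add_sum_Ico _ hle]
    refine add_le_add ?_ ?_
    · refine Finset.sum_le_sum fun j _ => ?_
      have : s ^ k * s ^ j ≤ 1 :=
        mul_le_one₀ (pow_le_one₀ hs hs1.le) (pow_nonneg hs j) (pow_le_one₀ hs hs1.le)
      have h2 := mul_le_mul_of_nonneg_left this (mul_nonneg (hf k) (hg j))
      nlinarith [h2]
    · calc ∑ j ∈ Ico (t + 1 - k) N, (s ^ k * f k) * (s ^ j * g j)
          ≤ ∑ j ∈ Ico (t + 1 - k) N, (s ^ t * f k) * g j := by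
            refine Finset.sum_le_sum fun j hj => ?_
            rw [Finset.mem_Ico] at hj
            have : s ^ k * s ^ j ≤ s ^ t := by
              rw [← pow_add]
              exact pow_le_pow_of_le_one hs hs1.le (by omega)
            have h2 := mul_le_mul_of_nonneg_left this (mul_nonneg (hf k) (hg j))
            nlinarith [h2]
        _ ≤ ∑ j ∈ range N, (s ^ t * f k) * g j := by
            refine Finset.sum_le_sum_of_subset_of_nonneg ?_ fun j _ _ =>
              mul_nonneg (mul_nonneg (pow_nonneg hs t) (hf k)) (hg j)
            intro j hj
            rw [Finset.mem_Ico] at hj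
            exact Finset.mem_range.2 hj.2
        _ ≤ s ^ t * f k := by
            rw [← Finset.mul_sum]
            exact mul_le_of_le_one_right (mul_nonneg (pow_nonneg hs t) (hf k)) (hg1 N)
  calc (F - s ^ N) * (G - s ^ N)
      ≤ (∑ k ∈ range N, s ^ k * f k) * ∑ j ∈ range N, s ^ j * g j :=
        mul_le_mul (hF N) (hG N) hN2.le (hN1.le.trans (hF N))
    _ = ∑ k ∈ range N, ∑ j ∈ range N, (s ^ k * f k) * (s ^ j * g j) := by
        rw [Finset.sum_mul_sum]
    _ ≤ ∑ k ∈ range N, ((∑ j ∈ range (t + 1 - k), f k * g j) + s ^ t * f k) :=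
        Finset.sum_le_sum fun k _ => hsplit k
    _ = (∑ k ∈ range (t + 1), ∑ j ∈ range (t + 1 - k), f k * g j) +
          s ^ t * ∑ k ∈ range N, f k := by
        rw [Finset.sum_add_distrib, ← Finset.mul_sum]
        congr 1
        symm
        refine Finset.sum_subset (Finset.range_mono hN) fun k _ hk => ?_
        rw [Finset.mem_range] at hk
        rw [show t + 1 - k = 0 by omega]
        simp
    _ ≤ _ := by
        have := mul_le_of_le_one_right (pow_nonneg hs t) (hf1 N)
        linarith

/-! ### Hitting times of a finite continuous-time chain -/

theorem heatRestr_eq_exp (P : Matrix V V ℝ) (y : V) (t : ℝ) :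
    heatRestr P y t = NormedSpace.exp (t • restrQ P y) := by
  rw [NormedSpace.exp_eq_tsum ℝ]
  unfold heatRestr
  refine tsum_congr fun k => ?_
  rw [smul_pow, smul_smul, div_eq_inv_mul]

theorem heatRestr_zero (P : Matrix V V ℝ) (y : V) : heatRestr P y 0 = 1 := by
  rw [heatRestr_eq_exp, zero_smul, NormedSpace.exp_zero]

theorem hasDerivAt_exp_smul_matrix {m : Type*} [Fintype m] [DecidableEq m] (A : Matrix m m ℝ)
    (t : ℝ) (i j : m) :
    HasDerivAt (fun s : ℝ => NormedSpace.exp (s • A) i j)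
      ((NormedSpace.exp (t • A) * A) i j) t := by
  open scoped Matrix.Norms.Operator in
  exact (Matrix.entryLinearMap ℝ ℝ i j).toContinuousLinearMap.hasFDerivAt.comp_hasDerivAt t
    (hasDerivAt_exp_smul_const (𝕂 := ℝ) A t)

theorem hasDerivAt_sum_heatRestr_mul (P : Matrix V V ℝ) (y : V) (a : {w : V // w ≠ y})
    (v : {w : V // w ≠ y} → ℝ) (t : ℝ) :
    HasDerivAt (fun s => ∑ w, heatRestr P y s a w * v w)
      (∑ w, heatRestr P y t a w * (restrQ P y).mulVec v w) t := by
  simp only [heatRestr_eq_exp]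
  have h := HasDerivAt.fun_sum (u := Finset.univ) fun w _ =>
    (hasDerivAt_exp_smul_matrix (restrQ P y) t a w).mul_const (v w)
  convert! h using 1
  change (NormedSpace.exp (t • restrQ P y)).mulVec ((restrQ P y).mulVec v) a =
    (NormedSpace.exp (t • restrQ P y) * restrQ P y).mulVec v a
  rw [Matrix.mulVec_mulVec]

theorem hasSum_exp_series_matrix {m : Type*} [Fintype m] [DecidableEq m] (A : Matrix m m ℝ) :
    HasSum (fun k : ℕ => ((Nat.factorial k : ℝ)⁻¹) • A ^ k) (NormedSpace.exp A) := by
  open scoped Matrix.Norms.Operator in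
  exact NormedSpace.exp_series_hasSum_exp' (𝕂 := ℝ) A

theorem exp_matrix_nonneg {m : Type*} [Fintype m] [DecidableEq m] {A : Matrix m m ℝ}
    (hA : ∀ i j, 0 ≤ A i j) (i j : m) : 0 ≤ NormedSpace.exp A i j := by
  have hpow : ∀ (k : ℕ) (i j : m), 0 ≤ (A ^ k) i j := by
    intro k
    induction k with
    | zero => intro i j; rw [pow_zero, Matrix.one_apply]; split_ifs <;> norm_num
    | succ k ih =>
      intro i j
      rw [pow_succ, Matrix.mul_apply]
      exact Finset.sum_nonneg fun l _ => mul_nonneg (ih i l) (hA l j)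
  have h := Pi.hasSum.1 (Pi.hasSum.1 (hasSum_exp_series_matrix A) i) j
  exact h.nonneg fun k => mul_nonneg (by positivity) (hpow k i j)

theorem heatRestr_nonneg {P : Matrix V V ℝ} (hP : ∀ i j, 0 ≤ P i j) (y : V) {t : ℝ}
    (ht : 0 ≤ t) (a w : {w : V // w ≠ y}) : 0 ≤ heatRestr P y t a w := by
  have hsplit : t • restrQ P y = t • (restrQ P y + 1) + (-t) • (1 : Matrix _ _ ℝ) := by
    rw [smul_add, neg_smul, add_neg_cancel_right]
  rw [heatRestr_eq_exp, hsplit, Matrix.exp_add_of_commute _ _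
    ((Commute.one_right _).smul_right _)]
  have hdiag : NormedSpace.exp ((-t) • (1 : Matrix {w : V // w ≠ y} {w : V // w ≠ y} ℝ)) =
      Real.exp (-t) • 1 := by
    rw [← Matrix.diagonal_one, ← Matrix.diagonal_smul, Matrix.exp_diagonal,
      ← Matrix.diagonal_smul]
    congr 1
    ext i
    simp [Pi.coe_exp, Real.exp_eq_exp_ℝ]
  rw [hdiag, mul_smul_comm, mul_one]
  refine mul_nonneg (Real.exp_pos _).le (exp_matrix_nonneg (fun i j => ?_) a w)
  have h : (restrQ P y + 1) i j = P i.1 j.1 := by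
    simp [restrQ, Matrix.one_apply]
  rw [Matrix.smul_apply, h]
  exact mul_nonneg ht (hP _ _)

theorem restrQ_mulVec (P : Matrix V V ℝ) (y : V) (h : V → ℝ) (w : {w : V // w ≠ y}) :
    (restrQ P y).mulVec (fun v => h v.1) w = ∑ v, P w.1 v * h v - P w.1 y * h y - h w.1 := by
  have h1 : ∑ v, P w.1 v * h v = ∑ v : {w : V // w ≠ y}, P w.1 v.1 * h v.1 + P w.1 y * h y := by
    rw [← Finset.sum_erase_add _ _ (Finset.mem_univ y)]
    congr 1
    refine Finset.sum_subtype _ (fun x => ?_) _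
    simp
  rw [h1, add_sub_cancel_right]
  simp [Matrix.mulVec, dotProduct, restrQ, sub_mul, Finset.sum_sub_distrib]

/-- the density of the hitting time of `y` for the continuous-time chain started at `a` -/
def hitDens (P : Matrix V V ℝ) (y : V) (a : {w : V // w ≠ y}) (s : ℝ) : ℝ :=
  ∑ w, heatRestr P y s a w * P w.1 y

theorem continuous_hitDens (P : Matrix V V ℝ) (y : V) (a : {w : V // w ≠ y}) :
    Continuous (hitDens P y a) :=
  continuous_iff_continuousAt.2 fun t =>
    (hasDerivAt_sum_heatRestr_mul P y a (fun w => P w.1 y) t).continuousAt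

theorem hitDens_nonneg {P : Matrix V V ℝ} (hP : ∀ i j, 0 ≤ P i j) {y : V}
    (a : {w : V // w ≠ y}) {s : ℝ} (hs : 0 ≤ s) : 0 ≤ hitDens P y a s :=
  Finset.sum_nonneg fun w _ => mul_nonneg (heatRestr_nonneg hP y hs a w) (hP _ _)

theorem hasDerivAt_exp_mul_sum_heatRestr (P : Matrix V V ℝ) (y : V) (a : {w : V // w ≠ y})
    (h : V → ℝ) (l t : ℝ) :
    HasDerivAt (fun s => Real.exp (-(l * s)) * ∑ w, heatRestr P y s a w * h w.1)
      (Real.exp (-(l * t)) * ∑ w : {w : V // w ≠ y}, heatRestr P y t a w *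
        (∑ v, P w.1 v * h v - P w.1 y * h y - (1 + l) * h w.1)) t := by
  have h1 : HasDerivAt (fun s : ℝ => Real.exp (-(l * s))) (Real.exp (-(l * t)) * (-l)) t := by
    have := ((hasDerivAt_id t).const_mul l).neg.exp
    simpa using this
  have h2 := hasDerivAt_sum_heatRestr_mul P y a (fun w => h w.1) t
  simp only [restrQ_mulVec] at h2
  convert! h1.mul h2 using 1
  simp only [Finset.mul_sum, ← Finset.sum_add_distrib]
  exact Finset.sum_congr rfl fun w _ => by ring

theorem continuous_exp_mul_sum_heatRestr (P : Matrix V V ℝ) (y : V) (a : {w : V // w ≠ y})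
    (v : {w : V // w ≠ y} → ℝ) (l : ℝ) :
    Continuous fun s : ℝ => Real.exp (-(l * s)) * ∑ w, heatRestr P y s a w * v w := by
  refine Continuous.mul (by fun_prop) (continuous_iff_continuousAt.2 fun t => ?_)
  exact (hasDerivAt_sum_heatRestr_mul P y a v t).continuousAt

theorem integral_exp_mul_sum_heatRestr (P : Matrix V V ℝ) (y : V) (a : {w : V // w ≠ y})
    (h : V → ℝ) (l T : ℝ) :
    ∫ s in (0 : ℝ)..T, Real.exp (-(l * s)) * ∑ w : {w : V // w ≠ y}, heatRestr P y s a w *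
        (∑ v, P w.1 v * h v - P w.1 y * h y - (1 + l) * h w.1) =
      Real.exp (-(l * T)) * ∑ w, heatRestr P y T a w * h w.1 - h a.1 := by
  rw [intervalIntegral.integral_eq_sub_of_hasDerivAt
    (fun s _ => hasDerivAt_exp_mul_sum_heatRestr P y a h l s)
    ((continuous_exp_mul_sum_heatRestr P y a _ l).intervalIntegrable _ _)]
  simp [heatRestr_zero, Matrix.one_apply]

theorem integral_exp_mul_hitDens_le {P : Matrix V V ℝ} (hP : ∀ i j, 0 ≤ P i j) {y : V} {l : ℝ}
    {h : V → ℝ} (h0 : ∀ x, 0 ≤ h x) (hy : 1 ≤ h y)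
    (hsup : ∀ x, x ≠ y → ∑ v, P x v * h v ≤ (1 + l) * h x) (a : {w : V // w ≠ y}) {T : ℝ}
    (hT : 0 ≤ T) :
    ∫ s in (0 : ℝ)..T, Real.exp (-(l * s)) * hitDens P y a s ≤ h a.1 := by
  have hint := integral_exp_mul_sum_heatRestr P y a h l T
  have hTnn : 0 ≤ Real.exp (-(l * T)) * ∑ w, heatRestr P y T a w * h w.1 :=
    mul_nonneg (Real.exp_pos _).le
      (Finset.sum_nonneg fun w _ => mul_nonneg (heatRestr_nonneg hP y hT a w) (h0 _))
  have hle : ∫ s in (0 : ℝ)..T, Real.exp (-(l * s)) * hitDens P y a s ≤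
      ∫ s in (0 : ℝ)..T, -(Real.exp (-(l * s)) * ∑ w : {w : V // w ≠ y}, heatRestr P y s a w *
        (∑ v, P w.1 v * h v - P w.1 y * h y - (1 + l) * h w.1)) := by
    refine intervalIntegral.integral_mono_on hT
      ((continuous_exp_mul_sum_heatRestr P y a _ l).intervalIntegrable _ _)
      ((continuous_exp_mul_sum_heatRestr P y a _ l).neg.intervalIntegrable _ _) fun s hs => ?_
    rw [hitDens, neg_mul_eq_mul_neg (Real.exp _), ← Finset.sum_neg_distrib]
    refine mul_le_mul_of_nonneg_left (Finset.sum_le_sum fun w _ => ?_) (Real.exp_pos _).le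
    rw [← mul_neg]
    refine mul_le_mul_of_nonneg_left ?_ (heatRestr_nonneg hP y hs.1 a w)
    have := hsup w.1 w.2
    have := le_mul_of_one_le_right (hP w.1 y) hy
    linarith
  rw [intervalIntegral.integral_neg, hint] at hle
  linarith

theorem sum_heatRestr_add_integral {P : Matrix V V ℝ} {y : V}
    (hP1 : ∀ x, x ≠ y → ∑ v, P x v = 1) (a : {w : V // w ≠ y}) (T : ℝ) :
    1 - ∑ w, heatRestr P y T a w = ∫ s in (0 : ℝ)..T, hitDens P y a s := by
  have hint := integral_exp_mul_sum_heatRestr P y a (fun _ => 1) 0 T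
  have h2 : ∀ w : {w : V // w ≠ y}, ∑ v, P w.1 v - P w.1 y - (1 : ℝ) = -P w.1 y := by
    intro w
    rw [hP1 w.1 w.2]
    ring
  simp only [mul_one, zero_mul, neg_zero, Real.exp_zero, one_mul, add_zero, h2, mul_neg,
    Finset.sum_neg_distrib, intervalIntegral.integral_neg] at hint
  unfold hitDens
  linarith

theorem le_integral_exp_mul_hitDens {P : Matrix V V ℝ} (hP : ∀ i j, 0 ≤ P i j) {y : V}
    (hP1 : ∀ x, x ≠ y → ∑ v, P x v = 1) {l : ℝ}
    {h : V → ℝ} (h1 : ∀ x, h x ≤ 1)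
    (hsub : ∀ x, x ≠ y → (1 + l) * h x ≤ ∑ v, P x v * h v) (a : {w : V // w ≠ y}) {T : ℝ}
    (hT : 0 ≤ T) :
    h a.1 - Real.exp (-(l * T)) ≤ ∫ s in (0 : ℝ)..T, Real.exp (-(l * s)) * hitDens P y a s := by
  have hint := integral_exp_mul_sum_heatRestr P y a h l T
  have hsurv : ∑ w, heatRestr P y T a w ≤ 1 := by
    have h2 : 0 ≤ ∫ s in (0 : ℝ)..T, hitDens P y a s :=
      intervalIntegral.integral_nonneg hT fun s hs => hitDens_nonneg hP a hs.1
    rw [← sum_heatRestr_add_integral hP1] at h2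
    linarith
  have hTle : Real.exp (-(l * T)) * ∑ w, heatRestr P y T a w * h w.1 ≤ Real.exp (-(l * T)) := by
    refine mul_le_of_le_one_right (Real.exp_pos _).le (le_trans ?_ hsurv)
    exact Finset.sum_le_sum fun w _ =>
      mul_le_of_le_one_right (heatRestr_nonneg hP y hT a w) (h1 _)
  have hle : ∫ s in (0 : ℝ)..T, -(Real.exp (-(l * s)) * ∑ w : {w : V // w ≠ y},
        heatRestr P y s a w * (∑ v, P w.1 v * h v - P w.1 y * h y - (1 + l) * h w.1)) ≤
      ∫ s in (0 : ℝ)..T, Real.exp (-(l * s)) * hitDens P y a s := by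
    refine intervalIntegral.integral_mono_on hT
      ((continuous_exp_mul_sum_heatRestr P y a _ l).neg.intervalIntegrable _ _)
      ((continuous_exp_mul_sum_heatRestr P y a _ l).intervalIntegrable _ _) fun s hs => ?_
    rw [hitDens, neg_mul_eq_mul_neg (Real.exp _), ← Finset.sum_neg_distrib]
    refine mul_le_mul_of_nonneg_left (Finset.sum_le_sum fun w _ => ?_) (Real.exp_pos _).le
    rw [← mul_neg]
    refine mul_le_mul_of_nonneg_left ?_ (heatRestr_nonneg hP y hs.1 a w)
    have := hsub w.1 w.2
    have := mul_le_of_le_one_right (hP w.1 y) (h1 y)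
    linarith
  rw [intervalIntegral.integral_neg, hint] at hle
  linarith

/-! ### Lower tails of the sum of two independent continuous times -/

theorem integral_mono_interval_of_continuous {f : ℝ → ℝ} (hf : Continuous f)
    (hf0 : ∀ s, 0 ≤ s → 0 ≤ f s) {a b c : ℝ} (ha : 0 ≤ a) (hab : a ≤ b) :
    ∫ s in b..c, f s ≤ ∫ s in a..c, f s := by
  rw [← intervalIntegral.integral_add_adjacent_intervals (hf.intervalIntegrable a b)
    (hf.intervalIntegrable b c)]
  have : 0 ≤ ∫ s in a..b, f s :=
    intervalIntegral.integral_nonneg hab fun s hs => hf0 s (ha.trans hs.1)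
  linarith

theorem integral_le_integral_of_le_continuous {f g : ℝ → ℝ} (hf : Continuous f)
    (hg : Continuous g) {a b : ℝ} (hab : a ≤ b) (h : ∀ s, a ≤ s → s ≤ b → f s ≤ g s) :
    ∫ s in a..b, f s ≤ ∫ s in a..b, g s :=
  intervalIntegral.integral_mono_on hab (hf.intervalIntegrable _ _) (hg.intervalIntegrable _ _)
    fun s hs => h s hs.1 hs.2

theorem continuous_integral_sub {g : ℝ → ℝ} (hg : Continuous g) (t : ℝ) :
    Continuous fun s => ∫ r in (0 : ℝ)..(t - s), g r :=
  (intervalIntegral.continuous_primitive (fun a b => hg.intervalIntegrable a b) 0).comp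
    (continuous_const.sub continuous_id)

/-- Chernoff bound for the lower tail of the sum of two independent times with densities `f`
and `g`. -/
theorem integral_convolution_le {f g : ℝ → ℝ} (hf : Continuous f) (hg : Continuous g)
    (hf0 : ∀ s, 0 ≤ s → 0 ≤ f s) (hg0 : ∀ s, 0 ≤ s → 0 ≤ g s) {l F G : ℝ} (hl : 0 ≤ l)
    (hF : ∀ T, 0 ≤ T → ∫ s in (0 : ℝ)..T, Real.exp (-(l * s)) * f s ≤ F)
    (hG : ∀ T, 0 ≤ T → ∫ s in (0 : ℝ)..T, Real.exp (-(l * s)) * g s ≤ G) {t : ℝ} (ht : 0 ≤ t) :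
    ∫ s in (0 : ℝ)..t, f s * ∫ r in (0 : ℝ)..(t - s), g r ≤ Real.exp (l * t) * (F * G) := by
  have hG0 : 0 ≤ G := by simpa using hG 0 le_rfl
  have hin : ∀ u, 0 ≤ u → ∫ r in (0 : ℝ)..u, g r ≤ Real.exp (l * u) * G := by
    intro u hu
    calc ∫ r in (0 : ℝ)..u, g r
        ≤ ∫ r in (0 : ℝ)..u, Real.exp (l * u) * (Real.exp (-(l * r)) * g r) := by
          refine integral_le_integral_of_le_continuous hg (by fun_prop) hu fun r hr hru => ?_
          rw [← mul_assoc, ← Real.exp_add]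
          refine le_mul_of_one_le_left (hg0 r hr) (Real.one_le_exp ?_)
          nlinarith
      _ ≤ _ := by
          rw [intervalIntegral.integral_const_mul]
          exact mul_le_mul_of_nonneg_left (hG u hu) (Real.exp_pos _).le
  calc ∫ s in (0 : ℝ)..t, f s * ∫ r in (0 : ℝ)..(t - s), g r
      ≤ ∫ s in (0 : ℝ)..t, (Real.exp (l * t) * G) * (Real.exp (-(l * s)) * f s) := by
        refine integral_le_integral_of_le_continuous (hf.mul (continuous_integral_sub hg t))
          (by fun_prop) ht fun s hs hst => ?_
        calc f s * ∫ r in (0 : ℝ)..(t - s), g r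
            ≤ f s * (Real.exp (l * (t - s)) * G) :=
              mul_le_mul_of_nonneg_left (hin _ (by linarith)) (hf0 s hs)
          _ = _ := by
              rw [show l * (t - s) = l * t + -(l * s) by ring, Real.exp_add]
              ring
    _ ≤ _ := by
        rw [intervalIntegral.integral_const_mul]
        calc _ ≤ Real.exp (l * t) * G * F :=
              mul_le_mul_of_nonneg_left (hF t ht) (mul_nonneg (Real.exp_pos _).le hG0)
          _ = _ := by ring

/-- A lower bound on the lower tail of the sum of two independent times with densities `f` and
`g`, in terms of their Laplace transforms at three points. -/
theorem laplace_mul_le_integral_convolution {f g : ℝ → ℝ} (hf : Continuous f)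
    (hg : Continuous g) (hf0 : ∀ s, 0 ≤ s → 0 ≤ f s) (hg0 : ∀ s, 0 ≤ s → 0 ≤ g s)
    {l₁ l l₂ F G F₁ G₁ F₂ G₂ : ℝ} (hl : 0 < l) (hl₁ : l₁ ≤ l) (hl₂ : l ≤ l₂)
    (hF : ∀ T, 0 ≤ T → F - Real.exp (-(l * T)) ≤ ∫ s in (0 : ℝ)..T, Real.exp (-(l * s)) * f s)
    (hG : ∀ T, 0 ≤ T → G - Real.exp (-(l * T)) ≤ ∫ s in (0 : ℝ)..T, Real.exp (-(l * s)) * g s)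
    (hF0 : 0 < F) (hG0 : 0 < G)
    (hF₁ : ∀ T, 0 ≤ T → ∫ s in (0 : ℝ)..T, Real.exp (-(l₁ * s)) * f s ≤ F₁)
    (hG₁ : ∀ T, 0 ≤ T → ∫ s in (0 : ℝ)..T, Real.exp (-(l₁ * s)) * g s ≤ G₁)
    (hF₂ : ∀ T, 0 ≤ T → ∫ s in (0 : ℝ)..T, Real.exp (-(l₂ * s)) * f s ≤ F₂)
    (hG₂ : ∀ T, 0 ≤ T → ∫ s in (0 : ℝ)..T, Real.exp (-(l₂ * s)) * g s ≤ G₂)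
    {t : ℝ} (ht : 0 ≤ t) (t₀ : ℝ) :
    F * G ≤ Real.exp (-((l - l₁) * t)) * (F₁ * G₁) + Real.exp ((l₂ - l) * t₀) * (F₂ * G₂) +
      Real.exp (-(l * t₀)) * ∫ s in (0 : ℝ)..t, f s * ∫ r in (0 : ℝ)..(t - s), g r := by
  have hlim : Tendsto (fun T : ℝ => Real.exp (-(l * T))) atTop (nhds 0) :=
    Real.tendsto_exp_neg_atTop_nhds_zero.comp (tendsto_id.const_mul_atTop hl)
  have hlimF : Tendsto (fun T => F - Real.exp (-(l * T))) atTop (nhds F) := by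
    simpa using hlim.const_sub F
  have hlimG : Tendsto (fun T => G - Real.exp (-(l * T))) atTop (nhds G) := by
    simpa using hlim.const_sub G
  refine le_of_tendsto (hlimF.mul hlimG) ?_
  filter_upwards [hlimF.eventually (lt_mem_nhds hF0), hlimG.eventually (lt_mem_nhds hG0),
    eventually_ge_atTop t] with T hT1 hT2 hT
  have hT0 : 0 ≤ T := ht.trans hT
  set A := Real.exp (-((l - l₁) * t)) with hA
  set B := Real.exp ((l₂ - l) * t₀) with hB
  set D := Real.exp (-(l * t₀)) with hD
  have hA0 : 0 < A := Real.exp_pos _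
  have hB0 : 0 < B := Real.exp_pos _
  have hD0 : 0 < D := Real.exp_pos _
  set J : ℝ → ℝ := fun k => ∫ r in (0 : ℝ)..T, Real.exp (-(k * r)) * g r with hJ
  have hcont : ∀ k, Continuous fun r => Real.exp (-(k * r)) * g r := fun k => by fun_prop
  have hnn : ∀ k r, 0 ≤ r → 0 ≤ Real.exp (-(k * r)) * g r := fun k r hr =>
    mul_nonneg (Real.exp_pos _).le (hg0 r hr)
  have hJ0 : ∀ k, 0 ≤ J k := fun k =>
    intervalIntegral.integral_nonneg hT0 fun r hr => hnn k r hr.1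
  have hfar : ∀ u, t ≤ u → Real.exp (-(l * u)) ≤ A * Real.exp (-(l₁ * u)) := by
    intro u hu
    rw [hA, ← Real.exp_add]
    refine Real.exp_le_exp.2 ?_
    nlinarith
  have hnear : ∀ u, Real.exp (-(l * u)) ≤ B * Real.exp (-(l₂ * u)) + D := by
    intro u
    rcases le_total u t₀ with hu | hu
    · have : Real.exp (-(l * u)) ≤ B * Real.exp (-(l₂ * u)) := by
        rw [hB, ← Real.exp_add]
        refine Real.exp_le_exp.2 ?_
        nlinarith
      linarith
    · have : Real.exp (-(l * u)) ≤ D := Real.exp_le_exp.2 (by nlinarith)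
      have : 0 ≤ B * Real.exp (-(l₂ * u)) := by positivity
      linarith
  have hexp : ∀ k s r : ℝ, Real.exp (-(k * (s + r))) = Real.exp (-(k * s)) * Real.exp (-(k * r)) :=
    fun k s r => by rw [← Real.exp_add]; ring_nf
  have hin1 : ∀ s, 0 ≤ s → s ≤ t → Real.exp (-(l * s)) * J l ≤
      A * Real.exp (-(l₁ * s)) * J l₁ + B * Real.exp (-(l₂ * s)) * J l₂ +
        D * ∫ r in (0 : ℝ)..(t - s), g r := by
    intro s hs hst
    have hts : 0 ≤ t - s := by linarith
    have htT : t - s ≤ T := by linarith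
    have h1 : Real.exp (-(l * s)) * ∫ r in (t - s)..T, Real.exp (-(l * r)) * g r ≤
        A * Real.exp (-(l₁ * s)) * J l₁ := by
      calc Real.exp (-(l * s)) * ∫ r in (t - s)..T, Real.exp (-(l * r)) * g r
          ≤ A * Real.exp (-(l₁ * s)) * ∫ r in (t - s)..T, Real.exp (-(l₁ * r)) * g r := by
            rw [← intervalIntegral.integral_const_mul, ← intervalIntegral.integral_const_mul]
            refine integral_le_integral_of_le_continuous (by fun_prop) (by fun_prop) htT
              fun r hr _ => ?_
            have := mul_le_mul_of_nonneg_right (hfar (s + r) (by linarith)) (hg0 r (by linarith))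
            rw [hexp, hexp] at this
            linarith
        _ ≤ _ := mul_le_mul_of_nonneg_left
            (integral_mono_interval_of_continuous (hcont l₁) (hnn l₁) le_rfl hts)
            (by positivity)
    have h2 : Real.exp (-(l * s)) * ∫ r in (0 : ℝ)..(t - s), Real.exp (-(l * r)) * g r ≤
        B * Real.exp (-(l₂ * s)) * J l₂ + D * ∫ r in (0 : ℝ)..(t - s), g r := by
      calc Real.exp (-(l * s)) * ∫ r in (0 : ℝ)..(t - s), Real.exp (-(l * r)) * g r
          ≤ B * Real.exp (-(l₂ * s)) * (∫ r in (0 : ℝ)..(t - s), Real.exp (-(l₂ * r)) * g r) +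
              D * ∫ r in (0 : ℝ)..(t - s), g r := by
            rw [← intervalIntegral.integral_const_mul, ← intervalIntegral.integral_const_mul,
              ← intervalIntegral.integral_const_mul, ← intervalIntegral.integral_add
              (Continuous.intervalIntegrable (by fun_prop) _ _)
              (Continuous.intervalIntegrable (by fun_prop) _ _)]
            refine integral_le_integral_of_le_continuous (by fun_prop) (by fun_prop) hts
              fun r hr _ => ?_
            have := mul_le_mul_of_nonneg_right (hnear (s + r)) (hg0 r hr)
            rw [hexp, hexp] at this
            linarith
        _ ≤ _ := by
            have : ∫ r in (0 : ℝ)..(t - s), Real.exp (-(l₂ * r)) * g r ≤ J l₂ := by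
              simp only [hJ]
              rw [← intervalIntegral.integral_add_adjacent_intervals
                ((hcont l₂).intervalIntegrable 0 (t - s))
                ((hcont l₂).intervalIntegrable (t - s) T)]
              have : 0 ≤ ∫ r in (t - s)..T, Real.exp (-(l₂ * r)) * g r :=
                intervalIntegral.integral_nonneg htT fun r hr => hnn l₂ r (hts.trans hr.1)
              linarith
            gcongr
    have h3 : J l = (∫ r in (0 : ℝ)..(t - s), Real.exp (-(l * r)) * g r) +
        ∫ r in (t - s)..T, Real.exp (-(l * r)) * g r :=
      (intervalIntegral.integral_add_adjacent_intervals ((hcont l).intervalIntegrable _ _)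
        ((hcont l).intervalIntegrable _ _)).symm
    rw [h3, mul_add]
    linarith
  have hin2 : ∀ s, t ≤ s → Real.exp (-(l * s)) * J l ≤
      A * Real.exp (-(l₁ * s)) * J l₁ := by
    intro s hs
    simp only [hJ]
    rw [← intervalIntegral.integral_const_mul, ← intervalIntegral.integral_const_mul]
    refine integral_le_integral_of_le_continuous (by fun_prop) (by fun_prop) hT0
      fun r hr _ => ?_
    have := mul_le_mul_of_nonneg_right (hfar (s + r) (by linarith)) (hg0 r hr)
    rw [hexp, hexp] at this
    linarith
  have hJ₁ : J l₁ ≤ G₁ := hG₁ T hT0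
  have hJ₂ : J l₂ ≤ G₂ := hG₂ T hT0
  have hJl : G - Real.exp (-(l * T)) ≤ J l := hG T hT0
  clear_value J
  have hcontf : ∀ k, Continuous fun s => Real.exp (-(k * s)) * f s := fun k => by fun_prop
  have hcontK := continuous_integral_sub hg t
  have ho1 : (∫ s in (0 : ℝ)..t, Real.exp (-(l * s)) * f s) * J l ≤
      A * J l₁ * (∫ s in (0 : ℝ)..t, Real.exp (-(l₁ * s)) * f s) +
      B * J l₂ * (∫ s in (0 : ℝ)..t, Real.exp (-(l₂ * s)) * f s) +
      D * ∫ s in (0 : ℝ)..t, f s * ∫ r in (0 : ℝ)..(t - s), g r := by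
    rw [← intervalIntegral.integral_mul_const, ← intervalIntegral.integral_const_mul,
      ← intervalIntegral.integral_const_mul, ← intervalIntegral.integral_const_mul,
      ← intervalIntegral.integral_add, ← intervalIntegral.integral_add]
    · refine integral_le_integral_of_le_continuous (by fun_prop) (by fun_prop) ht
        fun s hs hst => ?_
      have := mul_le_mul_of_nonneg_left (hin1 s hs hst) (hf0 s hs)
      linarith
    all_goals exact Continuous.intervalIntegrable (by fun_prop) _ _
  have ho2 : (∫ s in t..T, Real.exp (-(l * s)) * f s) * J l ≤
      A * J l₁ * (∫ s in t..T, Real.exp (-(l₁ * s)) * f s) := by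
    rw [← intervalIntegral.integral_mul_const, ← intervalIntegral.integral_const_mul]
    refine integral_le_integral_of_le_continuous (by fun_prop) (by fun_prop) hT
      fun s hs _ => ?_
    have := mul_le_mul_of_nonneg_left (hin2 s hs) (hf0 s (ht.trans hs))
    linarith
  have hsplit : ∀ k, ∫ s in (0 : ℝ)..T, Real.exp (-(k * s)) * f s =
      (∫ s in (0 : ℝ)..t, Real.exp (-(k * s)) * f s) + ∫ s in t..T, Real.exp (-(k * s)) * f s :=
    fun k => (intervalIntegral.integral_add_adjacent_intervals
      ((hcontf k).intervalIntegrable _ _) ((hcontf k).intervalIntegrable _ _)).symm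
  have hmul : ∀ {a b x y : ℝ}, 0 ≤ b → a ≤ x → b ≤ y → 0 ≤ x → a * b ≤ x * y :=
    fun hb hax hby hx => mul_le_mul hax hby hb hx
  have e1 : J l₁ * (∫ s in (0 : ℝ)..T, Real.exp (-(l₁ * s)) * f s) ≤ F₁ * G₁ := by
    rw [mul_comm]
    exact hmul (hJ0 _) (hF₁ T hT0) hJ₁ (by simpa using hF₁ 0 le_rfl)
  have e2 : J l₂ * (∫ s in (0 : ℝ)..t, Real.exp (-(l₂ * s)) * f s) ≤ F₂ * G₂ := by
    rw [mul_comm]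
    exact hmul (hJ0 _) (hF₂ t ht) hJ₂ (by simpa using hF₂ 0 le_rfl)
  have e3 : (F - Real.exp (-(l * T))) * (G - Real.exp (-(l * T))) ≤
      (∫ s in (0 : ℝ)..T, Real.exp (-(l * s)) * f s) * J l :=
    mul_le_mul (hF T hT0) hJl hT2.le (hT1.le.trans (hF T hT0))
  rw [hsplit] at e1 e3
  have e1' := mul_le_mul_of_nonneg_left e1 hA0.le
  have e2' := mul_le_mul_of_nonneg_left e2 hB0.le
  nlinarith

/-! ### Tail bounds for the biased birth-and-death chain -/

/-- the distance from a state to `z` -/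
def exDist (n : ℕ) (i : Fin (2 * n + 1)) : ℕ := if i.val ≤ n then i.val else i.val - n

/-- the cumulant function of a continuous-time walk on `ℤ` which jumps up at rate `2/3` and down
at rate `1/3` -/
def biasRate (θ : ℝ) : ℝ := (2 * Real.exp θ + Real.exp (-θ)) / 3 - 1

theorem sum_fin_ite_mul {m a b : ℕ} (ha : a < m) (hb : b < m) (hab : a ≠ b) (c e : ℝ)
    (F : ℕ → ℝ) :
    ∑ j : Fin m, (if j.val = a then c else if j.val = b then e else 0) * F j.val =
      c * F a + e * F b := by
  rw [Fin.sum_univ_eq_sum_range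
    (fun j => (if j = a then c else if j = b then e else 0) * F j) m]
  have h : ∀ j, (if j = a then c else if j = b then e else 0) * F j =
      (if j = a then c * F j else 0) + (if j = b then e * F j else 0) := by
    intro j
    by_cases h1 : j = a
    · have : j ≠ b := fun h2 => hab (h1.symm.trans h2)
      simp [h1, hab]
    · simp [h1]
  simp only [h, Finset.sum_add_distrib, Finset.sum_ite_eq', Finset.mem_range, ha, hb, if_true]

theorem exP_nonneg (n : ℕ) (i j : Fin (2 * n + 1)) : 0 ≤ exP n i j := by
  simp only [exP, Matrix.of_apply]
  split_ifs <;> norm_num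

theorem exDist_pos {n : ℕ} {i : Fin (2 * n + 1)} (hi : i ≠ exZ n) : 0 < exDist n i := by
  have : i.val ≠ 0 := fun h => hi (Fin.ext h)
  unfold exDist
  split_ifs <;> omega

theorem sum_exP_mul {n : ℕ} (hn : 2 ≤ n) {i : Fin (2 * n + 1)} (hi : i ≠ exZ n) (φ : ℕ → ℝ) :
    ∑ j, exP n i j * φ (exDist n j) =
      if exDist n i = n then φ (n - 1)
      else 2 / 3 * φ (exDist n i - 1) + 1 / 3 * φ (exDist n i + 1) := by
  have hi0 : i.val ≠ 0 := fun h => hi (Fin.ext h)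
  have hlt := i.isLt
  have hdown : (if exDown n i.val ≤ n then exDown n i.val else exDown n i.val - n) =
      exDist n i - 1 := by
    unfold exDown exDist
    split_ifs <;> omega
  simp only [exP, Matrix.of_apply, hi0, if_false]
  by_cases hend : i.val = n ∨ i.val = 2 * n
  · have hd : exDist n i = n := by
      unfold exDist
      split_ifs <;> omega
    have hbound : exDown n i.val < 2 * n + 1 := by
      unfold exDown
      split_ifs <;> omega
    have hne : exDown n i.val ≠ 2 * n := by
      unfold exDown
      split_ifs <;> omega
    have h := sum_fin_ite_mul hbound (by omega : 2 * n < 2 * n + 1) hne 1 0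
      (fun j => φ (if j ≤ n then j else j - n))
    simp only [ite_self, one_mul, zero_mul, add_zero, hdown, hd] at h
    simp only [hend, if_true, hd]
    exact h
  · have hd : exDist n i ≠ n := by
      unfold exDist
      split_ifs <;> omega
    have hbound : exDown n i.val < 2 * n + 1 := by
      unfold exDown
      split_ifs <;> omega
    have hne : exDown n i.val ≠ i.val + 1 := by
      unfold exDown
      split_ifs <;> omega
    have hup : (if i.val + 1 ≤ n then i.val + 1 else i.val + 1 - n) = exDist n i + 1 := by
      unfold exDist
      split_ifs <;> omega
    have h := sum_fin_ite_mul hbound (by omega : i.val + 1 < 2 * n + 1) hne (2 / 3) (1 / 3)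
      (fun j => φ (if j ≤ n then j else j - n))
    simp only [hdown, hup] at h
    simp only [hend, hd, if_false]
    exact h

theorem sum_exP {n : ℕ} (hn : 2 ≤ n) {i : Fin (2 * n + 1)} (hi : i ≠ exZ n) :
    ∑ j, exP n i j = 1 := by
  have h := sum_exP_mul hn hi (fun _ => 1)
  simp only [mul_one] at h
  rw [h]
  split_ifs <;> norm_num

theorem one_add_biasRate (θ : ℝ) :
    1 + biasRate θ = 2 / 3 * Real.exp θ + 1 / 3 * Real.exp (-θ) := by
  unfold biasRate
  ring

/-- a subsolution of `P h = (1 + λ) h` on the complement of `z` -/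
def exSub (n : ℕ) (θ : ℝ) (i : Fin (2 * n + 1)) : ℝ := Real.exp (-(θ * exDist n i))

/-- a supersolution of `P h = (1 + λ) h` on the complement of `z` -/
def exSup (n : ℕ) (θ : ℝ) (i : Fin (2 * n + 1)) : ℝ :=
  Real.exp (-(θ * exDist n i)) + Real.exp (-(θ * (2 * n - exDist n i)))

theorem exSub_le_one {n : ℕ} {θ : ℝ} (hθ : 0 ≤ θ) (i : Fin (2 * n + 1)) : exSub n θ i ≤ 1 :=
  Real.exp_le_one_iff.2 (neg_nonpos.2 (mul_nonneg hθ (Nat.cast_nonneg _)))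

theorem exSup_nonneg (n : ℕ) (θ : ℝ) (i : Fin (2 * n + 1)) : 0 ≤ exSup n θ i :=
  add_nonneg (Real.exp_pos _).le (Real.exp_pos _).le

theorem one_le_exSup (n : ℕ) (θ : ℝ) : 1 ≤ exSup n θ (exZ n) := by
  have : (0 : ℝ) ≤ Real.exp (-(θ * (2 * n - exDist n (exZ n)))) := (Real.exp_pos _).le
  have h0 : exDist n (exZ n) = 0 := by simp [exDist, exZ]
  unfold exSup
  rw [h0] at this ⊢
  simpa using this

theorem exDist_exA (n : ℕ) : exDist n (exA n) = n := by simp [exDist, exA]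

theorem exDist_exB (n : ℕ) : exDist n (exB n) = n := by
  have h : (exB n).val = 2 * n := rfl
  unfold exDist
  rw [h]
  by_cases h' : 2 * n ≤ n
  · rw [if_pos h']
    omega
  · rw [if_neg h']
    omega

theorem exSub_of_exDist_eq {n : ℕ} {i : Fin (2 * n + 1)} (hi : exDist n i = n) (θ : ℝ) :
    exSub n θ i = Real.exp (-(θ * n)) := by
  rw [exSub, hi]

theorem exSup_of_exDist_eq {n : ℕ} {i : Fin (2 * n + 1)} (hi : exDist n i = n) (θ : ℝ) :
    exSup n θ i = 2 * Real.exp (-(θ * n)) := by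
  rw [exSup, hi]
  ring_nf

theorem exp_le_exp_self {θ : ℝ} (hθ : 0 ≤ θ) : Real.exp (-θ) ≤ Real.exp θ :=
  Real.exp_le_exp.2 (by linarith)

theorem mul_exSub_le {n : ℕ} (hn : 2 ≤ n) {θ : ℝ} (hθ : 0 ≤ θ) {i : Fin (2 * n + 1)}
    (hi : i ≠ exZ n) : (1 + biasRate θ) * exSub n θ i ≤ ∑ j, exP n i j * exSub n θ j := by
  have h := sum_exP_mul hn hi (fun d => Real.exp (-(θ * d)))
  simp only [exSub]
  rw [h, one_add_biasRate]
  have hcast : ((exDist n i - 1 : ℕ) : ℝ) = exDist n i - 1 := by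
    rw [Nat.cast_sub (exDist_pos hi), Nat.cast_one]
  have e1 : ∀ d : ℝ, Real.exp (-(θ * (d - 1))) = Real.exp θ * Real.exp (-(θ * d)) := fun d => by
    rw [← Real.exp_add]; ring_nf
  have e2 : ∀ d : ℝ, Real.exp (-(θ * (d + 1))) = Real.exp (-θ) * Real.exp (-(θ * d)) := fun d => by
    rw [← Real.exp_add]; ring_nf
  have hle := exp_le_exp_self hθ
  split_ifs with hd
  · rw [hd] at hcast ⊢
    rw [hcast, e1]
    have := mul_le_mul_of_nonneg_right hle (Real.exp_pos (-(θ * n))).le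
    linarith
  · push_cast
    rw [hcast, e1, e2]
    linarith

theorem sum_exP_mul_exSup_le {n : ℕ} (hn : 2 ≤ n) {θ : ℝ} (hθ : 0 ≤ θ) {i : Fin (2 * n + 1)}
    (hi : i ≠ exZ n) : ∑ j, exP n i j * exSup n θ j ≤ (1 + biasRate θ) * exSup n θ i := by
  have h := sum_exP_mul hn hi (fun d => Real.exp (-(θ * d)) + Real.exp (-(θ * (2 * n - d))))
  simp only [exSup]
  rw [h, one_add_biasRate]
  have hcast : ((exDist n i - 1 : ℕ) : ℝ) = exDist n i - 1 := by
    rw [Nat.cast_sub (exDist_pos hi), Nat.cast_one]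
  have e1 : ∀ d : ℝ, Real.exp (-(θ * (d - 1))) = Real.exp θ * Real.exp (-(θ * d)) := fun d => by
    rw [← Real.exp_add]; ring_nf
  have e2 : ∀ d : ℝ, Real.exp (-(θ * (d + 1))) = Real.exp (-θ) * Real.exp (-(θ * d)) := fun d => by
    rw [← Real.exp_add]; ring_nf
  have e3 : ∀ d : ℝ, Real.exp (-(θ * (2 * n - (d - 1)))) =
      Real.exp (-θ) * Real.exp (-(θ * (2 * n - d))) := fun d => by
    rw [← Real.exp_add]; ring_nf
  have e4 : ∀ d : ℝ, Real.exp (-(θ * (2 * n - (d + 1)))) =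
      Real.exp θ * Real.exp (-(θ * (2 * n - d))) := fun d => by
    rw [← Real.exp_add]; ring_nf
  have hle := exp_le_exp_self hθ
  split_ifs with hd
  · rw [hd] at hcast ⊢
    rw [hcast, e1, e3]
    have e5 : Real.exp (-(θ * (2 * n - n : ℝ))) = Real.exp (-(θ * n)) := by ring_nf
    rw [e5]
    have := mul_le_mul_of_nonneg_right hle (Real.exp_pos (-(θ * n))).le
    linarith
  · push_cast
    rw [hcast, e1, e2, e3, e4]
    have := mul_le_mul_of_nonneg_right hle
      (Real.exp_pos (-(θ * (2 * n - exDist n i)))).le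
    linarith

theorem lazyM_nonneg {W : Type} [DecidableEq W] {P : Matrix W W ℝ} (hP : ∀ i j, 0 ≤ P i j)
    (i j : W) :
    0 ≤ lazyM P i j := by
  simp only [lazyM, Matrix.smul_apply, Matrix.add_apply, Matrix.one_apply, smul_eq_mul]
  have := hP i j
  split_ifs <;> positivity

theorem sum_lazyM_mul (P : Matrix V V ℝ) (h : V → ℝ) (i : V) :
    ∑ j, lazyM P i j * h j = (h i + ∑ j, P i j * h j) / 2 := by
  simp only [lazyM, Matrix.smul_apply, Matrix.add_apply, Matrix.one_apply, smul_eq_mul,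
    mul_assoc, ← Finset.mul_sum, add_mul, Finset.sum_add_distrib]
  simp
  ring

theorem biasRate_nonneg {θ : ℝ} (hθ : 0 ≤ θ) : 0 ≤ biasRate θ := by
  have h1 := Real.add_one_le_exp θ
  have h2 := Real.add_one_le_exp (-θ)
  unfold biasRate
  linarith

theorem biasRate_strictMonoOn {θ θ' : ℝ} (hθ : 0 ≤ θ) (h : θ < θ') :
    biasRate θ < biasRate θ' := by
  have h1 : Real.exp θ < Real.exp θ' := Real.exp_lt_exp.2 h
  have h2 : 1 ≤ Real.exp θ := Real.one_le_exp hθ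
  have h3 : Real.exp (-θ) - Real.exp (-θ') ≤ Real.exp θ' - Real.exp θ := by
    rw [Real.exp_neg, Real.exp_neg, inv_sub_inv (by positivity) (by positivity)]
    refine div_le_self (by linarith) ?_
    nlinarith
  unfold biasRate
  linarith

theorem sum_firstHit_exP_le {n : ℕ} (hn : 2 ≤ n) {θ : ℝ} (hθ : 0 ≤ θ) {a : Fin (2 * n + 1)}
    (ha : exDist n a = n) (N : ℕ) :
    ∑ k ∈ range N, (2 / (2 + biasRate θ)) ^ k * firstHit (lazyM (exP n)) a (exZ n) k ≤
      2 * Real.exp (-(θ * n)) := by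
  have hl := biasRate_nonneg hθ
  rw [← exSup_of_exDist_eq ha]
  refine sum_pow_mul_firstHit_le (lazyM_nonneg (exP_nonneg n)) (by positivity)
    (exSup_nonneg n θ) (one_le_exSup n θ) (fun x hx => ?_) N a
  have := sum_exP_mul_exSup_le hn hθ hx
  rw [sum_lazyM_mul, div_mul_div_comm, div_le_iff₀ (by positivity)]
  linarith

theorem le_sum_firstHit_exP {n : ℕ} (hn : 2 ≤ n) {θ : ℝ} (hθ : 0 ≤ θ) {a : Fin (2 * n + 1)}
    (ha : exDist n a = n) (N : ℕ) :
    Real.exp (-(θ * n)) - (2 / (2 + biasRate θ)) ^ N ≤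
      ∑ k ∈ range N, (2 / (2 + biasRate θ)) ^ k * firstHit (lazyM (exP n)) a (exZ n) k := by
  have hl := biasRate_nonneg hθ
  rw [← exSub_of_exDist_eq ha]
  refine sub_pow_le_sum_pow_mul_firstHit (lazyM_nonneg (exP_nonneg n)) (fun x hx => ?_)
    (by positivity) (exSub_le_one hθ) (fun x hx => ?_) N a
  · have := sum_lazyM_mul (exP n) (fun _ => 1) x
    simp only [mul_one, sum_exP hn hx] at this
    rw [this]
    norm_num
  · have := mul_exSub_le hn hθ hx
    rw [sum_lazyM_mul, div_mul_div_comm, le_div_iff₀ (by positivity)]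
    linarith

theorem sum_firstHit_exP_le_one {n : ℕ} (hn : 2 ≤ n) (a : Fin (2 * n + 1)) (N : ℕ) :
    ∑ k ∈ range N, firstHit (lazyM (exP n)) a (exZ n) k ≤ 1 := by
  have := sum_pow_mul_firstHit_le (lazyM_nonneg (exP_nonneg n)) (y := exZ n) zero_le_one
    (h := fun _ => 1) (fun _ => zero_le_one) le_rfl (fun x hx => ?_) N a
  · simpa using this
  · rw [sum_lazyM_mul]
    simp [sum_exP hn hx]

theorem exCDFd_mul_pow_le {n : ℕ} (hn : 2 ≤ n) {θ : ℝ} (hθ : 0 ≤ θ) (t : ℕ) :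
    exCDFd n t * (2 / (2 + biasRate θ)) ^ t ≤ 4 * Real.exp (-(2 * θ * n)) := by
  have hl := biasRate_nonneg hθ
  have h := sum_convolution_mul_pow_le
    (firstHit_nonneg (lazyM_nonneg (exP_nonneg n)) (exA n) (exZ n))
    (firstHit_nonneg (lazyM_nonneg (exP_nonneg n)) (exB n) (exZ n))
    (s := 2 / (2 + biasRate θ)) (by positivity)
    (div_le_one_of_le₀ (by linarith) (by linarith)) (sum_firstHit_exP_le hn hθ (exDist_exA n))
    (sum_firstHit_exP_le hn hθ (exDist_exB n)) t
  refine h.trans (le_of_eq ?_)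
  rw [show -(2 * θ * n) = -(θ * n) + -(θ * n) by ring, Real.exp_add]
  ring

theorem exp_le_exCDFd_add_pow {n : ℕ} (hn : 2 ≤ n) {θ : ℝ} (hθ : 0 < θ) (t : ℕ) :
    Real.exp (-(2 * θ * n)) ≤ exCDFd n t + (2 / (2 + biasRate θ)) ^ t := by
  have hl : 0 < biasRate θ :=
    (biasRate_nonneg le_rfl).trans_lt (biasRate_strictMonoOn le_rfl hθ)
  have h := mul_le_sum_convolution_add_pow
    (firstHit_nonneg (lazyM_nonneg (exP_nonneg n)) (exA n) (exZ n))
    (firstHit_nonneg (lazyM_nonneg (exP_nonneg n)) (exB n) (exZ n))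
    (s := 2 / (2 + biasRate θ)) (by positivity)
    ((div_lt_one (by linarith)).2 (by linarith)) (Real.exp_pos _) (Real.exp_pos _)
    (sum_firstHit_exP_le_one hn _) (sum_firstHit_exP_le_one hn _)
    (le_sum_firstHit_exP hn hθ.le (exDist_exA n)) (le_sum_firstHit_exP hn hθ.le (exDist_exB n)) t
  refine le_trans (le_of_eq ?_) h
  rw [show -(2 * θ * n) = -(θ * n) + -(θ * n) by ring, Real.exp_add]

theorem exA_ne_exZ {n : ℕ} (hn : 2 ≤ n) : exA n ≠ exZ n := fun h => by
  have := congrArg Fin.val h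
  simp only [exA, exZ] at this
  omega

theorem exB_ne_exZ {n : ℕ} (hn : 2 ≤ n) : exB n ≠ exZ n := fun h => by
  have := congrArg Fin.val h
  simp only [exB, exZ] at this
  omega

theorem exCDFc_eq {n : ℕ} (hn : 2 ≤ n) (t : ℝ) :
    exCDFc n t = ∫ s in (0 : ℝ)..t, hitDens (exP n) (exZ n) ⟨exA n, exA_ne_exZ hn⟩ s *
      ∫ r in (0 : ℝ)..(t - s), hitDens (exP n) (exZ n) ⟨exB n, exB_ne_exZ hn⟩ r := by
  unfold exCDFc
  congr 1
  ext s
  rw [exDens, dif_neg (exA_ne_exZ hn), exSurv, dif_neg (exB_ne_exZ hn),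
    sum_heatRestr_add_integral (fun x hx => sum_exP hn hx)]
  rfl

theorem integral_exp_mul_hitDens_exP_le {n : ℕ} (hn : 2 ≤ n) {θ : ℝ} (hθ : 0 ≤ θ)
    (a : {w : Fin (2 * n + 1) // w ≠ exZ n}) (ha : exDist n a.1 = n) (T : ℝ) (hT : 0 ≤ T) :
    ∫ s in (0 : ℝ)..T, Real.exp (-(biasRate θ * s)) * hitDens (exP n) (exZ n) a s ≤
      2 * Real.exp (-(θ * n)) := by
  rw [← exSup_of_exDist_eq ha]
  exact integral_exp_mul_hitDens_le (exP_nonneg n) (exSup_nonneg n θ) (one_le_exSup n θ)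
    (fun x hx => sum_exP_mul_exSup_le hn hθ hx) a hT

theorem le_integral_exp_mul_hitDens_exP {n : ℕ} (hn : 2 ≤ n) {θ : ℝ} (hθ : 0 ≤ θ)
    (a : {w : Fin (2 * n + 1) // w ≠ exZ n}) (ha : exDist n a.1 = n) (T : ℝ) (hT : 0 ≤ T) :
    Real.exp (-(θ * n)) - Real.exp (-(biasRate θ * T)) ≤
      ∫ s in (0 : ℝ)..T, Real.exp (-(biasRate θ * s)) * hitDens (exP n) (exZ n) a s := by
  rw [← exSub_of_exDist_eq ha]
  exact le_integral_exp_mul_hitDens (exP_nonneg n) (fun x hx => sum_exP hn hx)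
    (exSub_le_one hθ) (fun x hx => mul_exSub_le hn hθ hx) a hT

theorem two_exp_mul_two_exp (θ : ℝ) (n : ℕ) :
    2 * Real.exp (-(θ * n)) * (2 * Real.exp (-(θ * n))) = 4 * Real.exp (-(2 * θ * n)) := by
  rw [show -(2 * θ * n) = -(θ * n) + -(θ * n) by ring, Real.exp_add]
  ring

theorem exCDFc_le {n : ℕ} (hn : 2 ≤ n) {θ : ℝ} (hθ : 0 ≤ θ) {t : ℝ} (ht : 0 ≤ t) :
    exCDFc n t ≤ Real.exp (biasRate θ * t) * (4 * Real.exp (-(2 * θ * n))) := by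
  rw [exCDFc_eq hn, ← two_exp_mul_two_exp]
  exact integral_convolution_le (continuous_hitDens _ _ _) (continuous_hitDens _ _ _)
    (fun s hs => hitDens_nonneg (exP_nonneg n) _ hs)
    (fun s hs => hitDens_nonneg (exP_nonneg n) _ hs) (biasRate_nonneg hθ)
    (integral_exp_mul_hitDens_exP_le hn hθ _ (exDist_exA n))
    (integral_exp_mul_hitDens_exP_le hn hθ _ (exDist_exB n)) ht

theorem exp_le_exCDFc {n : ℕ} (hn : 2 ≤ n) {θ₁ θ θ₂ : ℝ} (hθ₁ : 0 ≤ θ₁) (h₁ : θ₁ < θ)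
    (h₂ : θ < θ₂) {t : ℝ} (ht : 0 ≤ t) (t₀ : ℝ) :
    Real.exp (-(2 * θ * n)) ≤
      Real.exp (-((biasRate θ - biasRate θ₁) * t)) * (4 * Real.exp (-(2 * θ₁ * n))) +
      Real.exp ((biasRate θ₂ - biasRate θ) * t₀) * (4 * Real.exp (-(2 * θ₂ * n))) +
      Real.exp (-(biasRate θ * t₀)) * exCDFc n t := by
  have hθ : 0 < θ := hθ₁.trans_lt h₁
  have hθ₂ : 0 ≤ θ₂ := (hθ.trans h₂).le
  have hl : 0 < biasRate θ :=
    (biasRate_nonneg le_rfl).trans_lt (biasRate_strictMonoOn le_rfl hθ)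
  rw [exCDFc_eq hn, ← two_exp_mul_two_exp, ← two_exp_mul_two_exp,
    show -(2 * θ * n) = -(θ * n) + -(θ * n) by ring, Real.exp_add]
  exact laplace_mul_le_integral_convolution (continuous_hitDens _ _ _) (continuous_hitDens _ _ _)
    (fun s hs => hitDens_nonneg (exP_nonneg n) _ hs)
    (fun s hs => hitDens_nonneg (exP_nonneg n) _ hs) hl
    (biasRate_strictMonoOn hθ₁ h₁).le (biasRate_strictMonoOn hθ.le h₂).le
    (le_integral_exp_mul_hitDens_exP hn hθ.le _ (exDist_exA n))
    (le_integral_exp_mul_hitDens_exP hn hθ.le _ (exDist_exB n))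
    (Real.exp_pos _) (Real.exp_pos _)
    (integral_exp_mul_hitDens_exP_le hn hθ₁ _ (exDist_exA n))
    (integral_exp_mul_hitDens_exP_le hn hθ₁ _ (exDist_exB n))
    (integral_exp_mul_hitDens_exP_le hn hθ₂ _ (exDist_exA n))
    (integral_exp_mul_hitDens_exP_le hn hθ₂ _ (exDist_exB n)) ht t₀


/-! ### Asymptotics of the quantiles `t_δ` and `τ_δ` -/

theorem two_div_pow_eq_exp {l : ℝ} (hl : 0 ≤ l) (t : ℕ) :
    (2 / (2 + l)) ^ t = Real.exp (-(t * Real.log (1 + l / 2))) := by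
  have h : 2 / (2 + l) = (1 + l / 2)⁻¹ := by
    field_simp
  rw [h, ← Real.exp_log (show (0 : ℝ) < (1 + l / 2)⁻¹ by positivity), ← Real.exp_nat_mul,
    Real.log_inv, mul_neg]

theorem log_one_add_mul_le {x : ℝ} (h0 : 0 ≤ x) (h3 : x ≤ 3) :
    Real.log (1 + x) * (1 + x / 6) ≤ x := by
  set s := √(1 + x) with hs
  have hs2 : s ^ 2 = 1 + x := Real.sq_sqrt (by linarith)
  have hs0 : 0 < s := Real.sqrt_pos.2 (by linarith)
  have hs1 : 1 ≤ s := by nlinarith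
  have hs3 : s ≤ 2 := by nlinarith
  have hlog : Real.log (1 + x) ≤ 2 * (s - 1) := by
    rw [← hs2, Real.log_pow]
    have := Real.log_le_sub_one_of_pos hs0
    push_cast
    linarith
  have hx : x = s ^ 2 - 1 := by linarith
  calc Real.log (1 + x) * (1 + x / 6) ≤ 2 * (s - 1) * (1 + x / 6) := by gcongr
    _ ≤ x := by
      rw [hx]
      nlinarith [mul_nonneg (mul_nonneg (sub_nonneg.2 hs1) (sub_nonneg.2 hs1)) (sub_nonneg.2 hs3),
        mul_nonneg (sub_nonneg.2 hs1) (sub_nonneg.2 hs3)]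

theorem div_one_add_le_log {x : ℝ} (h0 : 0 ≤ x) : x / (1 + x) ≤ Real.log (1 + x) := by
  have h := Real.one_sub_inv_le_log_of_pos (show 0 < 1 + x by linarith)
  refine le_trans (le_of_eq ?_) h
  field_simp
  ring

theorem div_three_le_biasRate (θ : ℝ) : θ / 3 ≤ biasRate θ := by
  have h1 := Real.add_one_le_exp θ
  have h2 := Real.add_one_le_exp (-θ)
  unfold biasRate
  linarith

theorem biasRate_le {θ : ℝ} (h0 : 0 ≤ θ) (h1 : θ ≤ 1) : biasRate θ ≤ θ / 3 + θ ^ 2 := by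
  have h1 := (abs_le.1 (Real.abs_exp_sub_one_sub_id_le (x := θ) (by rwa [abs_of_nonneg h0]))).2
  have h2 := (abs_le.1 (Real.abs_exp_sub_one_sub_id_le (x := -θ)
    (by rwa [abs_neg, abs_of_nonneg h0]))).2
  unfold biasRate
  nlinarith

/-- The derivative of `biasRate`. -/
def biasSlope (θ : ℝ) : ℝ := (2 * Real.exp θ - Real.exp (-θ)) / 3

theorem hasDerivAt_biasRate (θ : ℝ) : HasDerivAt biasRate (biasSlope θ) θ := by
  have h1 := (Real.hasDerivAt_exp θ).const_mul 2
  have h2 := (hasDerivAt_neg θ).exp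
  convert! ((h1.add h2).div_const 3).sub_const 1 using 1
  unfold biasSlope
  ring

theorem third_le_biasSlope {θ : ℝ} (h0 : 0 ≤ θ) : 1 / 3 ≤ biasSlope θ := by
  have h1 := Real.add_one_le_exp θ
  have h2 : Real.exp (-θ) ≤ 1 := Real.exp_le_one_iff.2 (by linarith)
  unfold biasSlope
  linarith

theorem biasSlope_le_two {θ : ℝ} (h1 : θ ≤ 1) : biasSlope θ ≤ 2 := by
  have h1 := Real.exp_le_exp.2 h1
  have h2 := Real.exp_pos (-θ)
  have h3 := Real.exp_one_lt_d9
  unfold biasSlope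
  linarith

/-- The limiting decay rate `2θ - 2Λ(θ)/Λ'(θ)`, where `Λ = biasRate`. -/
def biasDecay (θ : ℝ) : ℝ := 2 * θ - 2 * biasRate θ / biasSlope θ

theorem biasDecay_zero : biasDecay 0 = 0 := by
  simp only [biasDecay, biasRate, neg_zero, Real.exp_zero]
  norm_num

theorem biasDecay_le {θ : ℝ} (h0 : 0 ≤ θ) (h1 : θ ≤ 1) : biasDecay θ ≤ 12 * θ ^ 2 := by
  have hD := third_le_biasSlope h0
  have hL := div_three_le_biasRate θ
  have hDle : biasSlope θ ≤ 1 / 3 + θ + 2 * θ ^ 2 / 3 := by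
    have h1 := (abs_le.1 (Real.abs_exp_sub_one_sub_id_le (x := θ) (by rwa [abs_of_nonneg h0]))).2
    have h2 := Real.add_one_le_exp (-θ)
    unfold biasSlope
    linarith
  unfold biasDecay
  rw [sub_le_iff_le_add, ← sub_le_iff_le_add', le_div_iff₀ (by linarith)]
  have hprod := mul_le_mul_of_nonneg_left hDle h0
  nlinarith [mul_le_mul_of_nonneg_left hD (sq_nonneg θ),
    mul_le_mul_of_nonneg_left h1 (sq_nonneg θ)]

theorem le_biasDecay_one : 2 / 5 ≤ biasDecay 1 := by
  have h1 := Real.exp_one_lt_d9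
  have h2 := Real.exp_one_gt_d9
  have h3 : Real.exp (-1) * Real.exp 1 = 1 := by rw [← Real.exp_add]; norm_num
  have h4 : Real.exp (-1) ≤ 2 / 5 := by nlinarith [Real.exp_pos (-1)]
  unfold biasDecay
  rw [le_sub_comm, div_le_iff₀ (by linarith [third_le_biasSlope zero_le_one])]
  unfold biasRate biasSlope
  linarith

theorem continuousOn_biasDecay : ContinuousOn biasDecay (Set.Icc 0 1) := by
  unfold biasDecay biasRate
  refine ContinuousOn.sub (by fun_prop) (ContinuousOn.div (by fun_prop) ?_ ?_)
  · unfold biasSlope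
    fun_prop
  · intro θ hθ
    have := third_le_biasSlope hθ.1
    linarith

theorem exists_biasDecay_eq {y : ℝ} (h0 : 0 < y) (h1 : y ≤ 2 / 5) :
    ∃ θ, 0 < θ ∧ θ ≤ 1 ∧ biasDecay θ = y := by
  obtain ⟨θ, hθ, rfl⟩ := intermediate_value_Icc zero_le_one continuousOn_biasDecay
    (show y ∈ Set.Icc (biasDecay 0) (biasDecay 1) by
      rw [biasDecay_zero]
      exact ⟨h0.le, h1.trans le_biasDecay_one⟩)
  refine ⟨θ, hθ.1.lt_of_ne ?_, hθ.2, rfl⟩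
  rintro rfl
  rw [biasDecay_zero] at h0
  exact h0.false

theorem eventually_pos_of_hasDerivAt_pos {f : ℝ → ℝ} {f' : ℝ} (h : HasDerivAt f f' 0)
    (h0 : f 0 = 0) (hf : 0 < f') : ∀ᶠ x in nhdsWithin 0 (Set.Ioi 0), 0 < f x := by
  have h1 := (hasDerivAt_iff_tendsto_slope_zero.1 h).eventually (lt_mem_nhds hf)
  have h2 := h1.filter_mono (nhdsWithin_mono 0 fun x (hx : 0 < x) => hx.ne')
  filter_upwards [h2, self_mem_nhdsWithin] with x hx hpos
  rw [zero_add, h0, sub_zero, smul_eq_mul] at hx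
  exact (pos_iff_pos_of_mul_pos hx).1 (inv_pos.2 hpos)

theorem exists_bracketing_tilt {θ ε ε' : ℝ} (hθ : 0 < θ) (hε : 0 < ε) (hε' : 0 < ε') :
    ∃ η, 0 < η ∧ η ≤ θ ∧
      0 < (biasRate θ - biasRate (θ - η)) * (2 / biasSlope θ + ε) - 2 * η ∧
      0 < 2 * η - (biasRate (θ + η) - biasRate θ) * (2 / biasSlope θ - ε') := by
  have hD : 0 < biasSlope θ := by linarith [third_le_biasSlope hθ.le]
  have hid := hasDerivAt_id (0 : ℝ)
  have h1 : HasDerivAt (fun η => (biasRate θ - biasRate (θ - η)) * (2 / biasSlope θ + ε) - 2 * η)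
      (biasSlope θ * (2 / biasSlope θ + ε) - 2) 0 := by
    have h := HasDerivAt.comp (0 : ℝ) (h₂ := biasRate) (h := fun η => θ - η)
      (by rw [sub_zero]; exact hasDerivAt_biasRate θ) (hid.const_sub θ)
    convert! ((h.const_sub (biasRate θ)).mul_const (2 / biasSlope θ + ε)).sub
      (hid.const_mul 2) using 1
    ring
  have h2 : HasDerivAt (fun η => 2 * η - (biasRate (θ + η) - biasRate θ) *
      (2 / biasSlope θ - ε')) (2 - biasSlope θ * (2 / biasSlope θ - ε')) 0 := by
    have h := HasDerivAt.comp (0 : ℝ) (h₂ := biasRate) (h := fun η => θ + η)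
      (by rw [add_zero]; exact hasDerivAt_biasRate θ) (hid.const_add θ)
    convert! (hid.const_mul 2).sub
      ((h.sub_const (biasRate θ)).mul_const (2 / biasSlope θ - ε')) using 1
    ring
  have e1 : biasSlope θ * (2 / biasSlope θ + ε) - 2 = biasSlope θ * ε := by field_simp; ring
  have e2 : 2 - biasSlope θ * (2 / biasSlope θ - ε') = biasSlope θ * ε' := by field_simp; ring
  have p1 := eventually_pos_of_hasDerivAt_pos h1 (by simp) (by rw [e1]; positivity)
  have p2 := eventually_pos_of_hasDerivAt_pos h2 (by simp) (by rw [e2]; positivity)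
  obtain ⟨η, q1, q2, q3⟩ := (p1.and (p2.and (Ioc_mem_nhdsGT hθ))).exists
  exact ⟨η, q3.1, q3.2, q1, q2⟩

theorem eventually_le_mul_natCast (B : ℝ) {c : ℝ} (hc : 0 < c) :
    ∀ᶠ n : ℕ in atTop, B ≤ c * n :=
  (tendsto_natCast_atTop_atTop.const_mul_atTop hc).eventually_ge_atTop B

theorem eventually_exp_le_exCDFc {θ ε ξ : ℝ} (hθ : 0 < θ) (hε : 0 < ε) (hξ : 0 < ξ) :
    ∀ᶠ n : ℕ in atTop,
      Real.exp (-((biasDecay θ + ξ) * n)) ≤ exCDFc n ((2 / biasSlope θ + ε) * n) := by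
  have hL : 0 < biasRate θ := by linarith [div_three_le_biasRate θ]
  have hD : 0 < biasSlope θ := by linarith [third_le_biasSlope hθ.le]
  obtain ⟨η, hη, hηθ, hg, hh⟩ :=
    exists_bracketing_tilt hθ hε (show 0 < ξ / (2 * biasRate θ) by positivity)
  set g := (biasRate θ - biasRate (θ - η)) * (2 / biasSlope θ + ε) - 2 * η with hgdef
  set h := 2 * η - (biasRate (θ + η) - biasRate θ) * (2 / biasSlope θ - ξ / (2 * biasRate θ))
    with hhdef
  filter_upwards [eventually_le_mul_natCast (Real.log 16) hg,
    eventually_le_mul_natCast (Real.log 16) hh, eventually_le_mul_natCast (2 * Real.log 2) hξ,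
    eventually_ge_atTop 2] with n n1 n2 n3 hn
  have key := exp_le_exCDFc hn (show 0 ≤ θ - η by linarith) (show θ - η < θ by linarith)
    (show θ < θ + η by linarith) (show 0 ≤ (2 / biasSlope θ + ε) * n by positivity)
    ((2 / biasSlope θ - ξ / (2 * biasRate θ)) * n)
  have small : ∀ y : ℝ, Real.log 16 ≤ y → Real.exp (-y) ≤ 1 / 16 := fun y hy => by
    rw [Real.exp_neg, one_div]
    exact inv_anti₀ (by norm_num) ((Real.log_le_iff_le_exp (by norm_num)).1 hy)
  have t1 : Real.exp (-((biasRate θ - biasRate (θ - η)) * ((2 / biasSlope θ + ε) * n))) *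
      (4 * Real.exp (-(2 * (θ - η) * n))) =
      4 * (Real.exp (-(g * n)) * Real.exp (-(2 * θ * n))) := by
    rw [mul_left_comm, ← Real.exp_add, ← Real.exp_add, hgdef]
    ring_nf
  have t2 : Real.exp ((biasRate (θ + η) - biasRate θ) *
      ((2 / biasSlope θ - ξ / (2 * biasRate θ)) * n)) * (4 * Real.exp (-(2 * (θ + η) * n))) =
      4 * (Real.exp (-(h * n)) * Real.exp (-(2 * θ * n))) := by
    rw [mul_left_comm, ← Real.exp_add, ← Real.exp_add, hhdef]
    ring_nf
  rw [t1, t2] at key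
  have s1 := mul_le_mul_of_nonneg_right (small _ n1) (Real.exp_pos (-(2 * θ * n))).le
  have s2 := mul_le_mul_of_nonneg_right (small _ n2) (Real.exp_pos (-(2 * θ * n))).le
  have key2 : 1 / 2 * Real.exp (-(2 * θ * n)) ≤
      Real.exp (-(biasRate θ * ((2 / biasSlope θ - ξ / (2 * biasRate θ)) * n))) *
        exCDFc n ((2 / biasSlope θ + ε) * n) := by linarith
  have hhalf : (1 / 2 : ℝ) = Real.exp (-Real.log 2) := by
    rw [Real.exp_neg, Real.exp_log two_pos, one_div]
  rw [hhalf, ← Real.exp_add] at key2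
  refine le_of_mul_le_mul_left (le_trans ?_ key2)
    (Real.exp_pos (-(biasRate θ * ((2 / biasSlope θ - ξ / (2 * biasRate θ)) * n))))
  rw [← Real.exp_add, Real.exp_le_exp]
  have e : biasRate θ * ((2 / biasSlope θ - ξ / (2 * biasRate θ)) * n) =
      (2 * biasRate θ / biasSlope θ) * n - ξ / 2 * n := by
    field_simp
  rw [e]
  unfold biasDecay
  linarith

theorem two_rpow_neg_eq_exp (x : ℝ) : (2 : ℝ) ^ (-x) = Real.exp (-(Real.log 2 * x)) := by
  rw [Real.rpow_def_of_pos two_pos, mul_neg]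

theorem two_mul_le_of_two_rpow_le_exCDFd {n t : ℕ} (hn : 2 ≤ n) {θ x : ℝ} (hθ : 0 ≤ θ)
    (h : (2 : ℝ) ^ (-x) ≤ exCDFd n t) :
    2 * θ * n ≤ Real.log 2 * x + Real.log 4 + t * Real.log (1 + biasRate θ / 2) := by
  have h1 := exCDFd_mul_pow_le hn hθ t
  rw [two_rpow_neg_eq_exp] at h
  rw [two_div_pow_eq_exp (biasRate_nonneg hθ)] at h1
  have h2 := (mul_le_mul_of_nonneg_right h (Real.exp_pos _).le).trans h1
  rw [← Real.exp_add, ← Real.exp_log (show (0 : ℝ) < 4 by norm_num), ← Real.exp_add,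
    Real.exp_le_exp] at h2
  linarith

theorem two_mul_le_of_two_rpow_le_exCDFc {n : ℕ} {t : ℝ} (hn : 2 ≤ n) {θ x : ℝ} (hθ : 0 ≤ θ)
    (ht : 0 ≤ t) (h : (2 : ℝ) ^ (-x) ≤ exCDFc n t) :
    2 * θ * n ≤ Real.log 2 * x + Real.log 4 + biasRate θ * t := by
  have h1 := exCDFc_le hn hθ ht
  rw [two_rpow_neg_eq_exp] at h
  have h2 := h.trans h1
  rw [mul_left_comm, ← Real.exp_add, ← Real.exp_log (show (0 : ℝ) < 4 by norm_num),
    ← Real.exp_add, Real.exp_le_exp] at h2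
  linarith

theorem eventually_two_rpow_le_exCDFd {δ : ℝ} (hδ : 0 < δ) :
    ∀ᶠ n : ℕ in atTop, ∃ t : ℕ, (t : ℝ) ≤ 12 * n + 2 * δ * n ∧
      (2 : ℝ) ^ (-(δ * n)) ≤ exCDFd n t := by
  have hθ : 0 < δ / 4 := by positivity
  set θ := δ / 4 with hθdef
  have hL : 0 < biasRate θ := by linarith [div_three_le_biasRate θ]
  have hlog : 0 < Real.log (1 + biasRate θ / 2) := Real.log_pos (by linarith)
  have hl2 := Real.log_two_gt_d9
  filter_upwards [eventually_ge_atTop 2, eventually_le_mul_natCast (2 + 6 / θ) hδ,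
    eventually_le_mul_natCast (Real.log 2) (show 0 < (Real.log 2 - 1 / 2) * δ by
      exact mul_pos (by linarith) hδ)] with n hn n1 n2
  have hn0 : (0 : ℝ) ≤ n := n.cast_nonneg
  set y := (2 * θ * n + 1) / Real.log (1 + biasRate θ / 2) with hy
  have hy0 : 0 ≤ y := by positivity
  refine ⟨⌈y⌉₊, ?_, ?_⟩
  · have h1 := (Nat.ceil_lt_add_one hy0).le
    have h2 : y ≤ (2 * θ * n + 1) * (1 + 6 / θ) := by
      rw [hy, div_le_iff₀ hlog, mul_assoc (2 * θ * n + 1)]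
      refine le_mul_of_one_le_right (by positivity) ?_
      have h3 := div_one_add_le_log (x := biasRate θ / 2) (by positivity)
      have h4 := div_three_le_biasRate θ
      refine le_trans ?_ (mul_le_mul_of_nonneg_left h3 (by positivity))
      rw [← mul_div_assoc, le_div_iff₀ (by positivity), add_mul]
      have h5 : 1 ≤ 6 / θ * (biasRate θ / 2) := by
        calc (1 : ℝ) = 6 / θ * (θ / 3 / 2) := by field_simp; norm_num
          _ ≤ _ := by gcongr
      linarith
    have h3 : (2 * θ * n + 1) * (1 + 6 / θ) = 12 * n + 2 * θ * n + 1 + 6 / θ := by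
      field_simp
      ring
    have h4 : 2 * θ * n = δ * n / 2 := by rw [hθdef]; ring
    have h5 : 0 ≤ δ * n := by positivity
    linarith
  · have key := exp_le_exCDFd_add_pow hn hθ ⌈y⌉₊
    rw [two_div_pow_eq_exp hL.le] at key
    have h1 : 2 * θ * n + 1 ≤ ⌈y⌉₊ * Real.log (1 + biasRate θ / 2) := by
      rw [← div_le_iff₀ hlog]
      exact Nat.le_ceil y
    have hhalf : Real.exp (-Real.log 2) = 1 / 2 := by
      rw [Real.exp_neg, Real.exp_log two_pos, one_div]
    have h2 : Real.exp (-(⌈y⌉₊ * Real.log (1 + biasRate θ / 2))) ≤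
        1 / 2 * Real.exp (-(2 * θ * n)) := by
      rw [← hhalf, ← Real.exp_add, Real.exp_le_exp]
      linarith [Real.log_two_lt_d9]
    have h3 : (2 : ℝ) ^ (-(δ * n)) ≤ 1 / 2 * Real.exp (-(2 * θ * n)) := by
      rw [two_rpow_neg_eq_exp, ← hhalf, ← Real.exp_add, Real.exp_le_exp]
      have h4 : 2 * θ * n = δ * n / 2 := by rw [hθdef]; ring
      linarith
    linarith

theorem eventually_tdelta_sub_le {δ : ℝ} (h0 : 0 < δ) (h1 : δ ≤ 1) :
    ∀ᶠ n : ℕ in atTop, (∃ t : ℝ, 0 ≤ t ∧ (2 : ℝ) ^ (-(δ * n)) ≤ exCDFc n t) →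
      (tdelta n δ : ℝ) - 2 * taudelta n δ ≤ 50 * √δ * n := by
  set θ := √δ with hθ
  have hθ2 : θ ^ 2 = δ := Real.sq_sqrt h0.le
  have hθ0 : 0 < θ := Real.sqrt_pos.2 h0
  have hθ1 : θ ≤ 1 := Real.sqrt_le_one.2 h1
  filter_upwards [eventually_two_rpow_le_exCDFd h0, eventually_ge_atTop 2,
    eventually_le_mul_natCast (Real.log 4) (show 0 < (1 - Real.log 2) * δ by
      exact mul_pos (by linarith [Real.log_two_lt_d9]) h0)] with n ⟨t, ht, hmem⟩ hn hlog hne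
  have hn0 : (0 : ℝ) ≤ n := n.cast_nonneg
  have hd : (tdelta n δ : ℝ) ≤ 12 * n + 2 * δ * n :=
    le_trans (Nat.cast_le.2 (Nat.sInf_le hmem)) ht
  have hc : 6 * (1 - 4 * θ) * n ≤ taudelta n δ := by
    refine le_csInf hne ?_
    rintro t ⟨ht, hmem⟩
    have key := two_mul_le_of_two_rpow_le_exCDFc hn hθ0.le ht hmem
    have h2 := mul_le_mul_of_nonneg_right (biasRate_le hθ0.le hθ1) ht
    have h3 : 2 * θ * n ≤ δ * n + (θ / 3 + θ ^ 2) * t := by linarith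
    rw [← hθ2] at h3
    have h4 : 2 * n ≤ θ * n + (1 / 3 + θ) * t := by
      refine le_of_mul_le_mul_left (le_trans (le_of_eq ?_) (h3.trans (le_of_eq ?_))) hθ0 <;> ring
    refine le_of_mul_le_mul_left ?_ (show 0 < 1 / 3 + θ by positivity)
    nlinarith [mul_nonneg (sq_nonneg θ) hn0, mul_nonneg hθ0.le hn0]
  have h5 : δ * n ≤ θ * n := by
    rw [← hθ2]
    gcongr
    nlinarith
  linarith

theorem eventually_le_tdelta_sub {δ : ℝ} (h0 : 0 < δ) (h1 : δ < 1 / 2) :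
    ∀ᶠ n : ℕ in atTop, (∃ t : ℝ, 0 ≤ t ∧ (2 : ℝ) ^ (-(δ * n)) ≤ exCDFc n t) ∧
      1 / 504 * √δ * n ≤ (tdelta n δ : ℝ) - 2 * taudelta n δ := by
  have hl := Real.log_two_gt_d9
  have hu := Real.log_two_lt_d9
  set δ' := Real.log 2 * δ with hδ'
  have hδ'0 : 0 < δ' := by positivity
  have hδ'1 : δ' ≤ 2 / 5 := by
    have := mul_le_mul hu.le h1.le h0.le (by norm_num)
    linarith
  obtain ⟨θ, hθ0, hθ1, hθ⟩ := exists_biasDecay_eq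
    (show 0 < δ' - δ' / 17280 by linarith) (by linarith)
  set ξ := δ' / 17280 with hξ
  have hξ0 : 0 < ξ := by positivity
  have hdecay := biasDecay_le hθ0.le hθ1
  have hδ'θ : δ' ≤ 24 * θ ^ 2 := by linarith
  have hsqrt : √δ ≤ 7 * θ := by
    refine Real.sqrt_le_iff.2 ⟨by positivity, ?_⟩
    have : 1 / 2 * δ ≤ δ' := mul_le_mul_of_nonneg_right (by linarith) h0.le
    nlinarith [sq_nonneg θ]
  have hL3 := div_three_le_biasRate θ
  have hLle := biasRate_le hθ0.le hθ1
  have hθsq : θ ^ 2 ≤ 1 := by nlinarith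
  have hD3 := third_le_biasSlope hθ0.le
  have hD2 := biasSlope_le_two hθ1
  have hlog3 := log_one_add_mul_le (show 0 ≤ biasRate θ / 2 by linarith) (by linarith)
  have hlogθ : θ / 10 ≤ Real.log (1 + biasRate θ / 2) := by
    refine le_trans ?_ (div_one_add_le_log (show 0 ≤ biasRate θ / 2 by linarith))
    rw [le_div_iff₀ (by linarith)]
    nlinarith
  have hrate : (4 / biasSlope θ + θ / 36) * Real.log (1 + biasRate θ / 2) ≤
      2 * biasRate θ / biasSlope θ - 2 * ξ := by
    have hfrac : θ / 18 ≤ biasRate θ / (3 * biasSlope θ) := by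
      rw [le_div_iff₀ (by positivity)]
      nlinarith
    have h2 := mul_le_mul_of_nonneg_left hlog3 (show 0 ≤ 4 / biasSlope θ by positivity)
    have e1 : 4 / biasSlope θ * (Real.log (1 + biasRate θ / 2) * (1 + biasRate θ / 2 / 6)) =
        Real.log (1 + biasRate θ / 2) * (4 / biasSlope θ + biasRate θ / (3 * biasSlope θ)) := by
      field_simp
      ring
    have e2 : 4 / biasSlope θ * (biasRate θ / 2) = 2 * biasRate θ / biasSlope θ := by ring
    rw [e1, e2] at h2
    have h3 := mul_le_mul_of_nonneg_left hfrac (show 0 ≤ Real.log (1 + biasRate θ / 2) by linarith)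
    have h4 := mul_le_mul_of_nonneg_right hlogθ hθ0.le
    linarith
  filter_upwards [eventually_exp_le_exCDFc hθ0 (show 0 < θ / 144 by positivity) hξ0,
    eventually_two_rpow_le_exCDFd h0, eventually_le_mul_natCast (Real.log 4) hξ0,
    eventually_ge_atTop 2] with n hc ⟨t₁, _, ht₁⟩ n1 hn
  have hn0 : (0 : ℝ) ≤ n := n.cast_nonneg
  have hmem : 0 ≤ (2 / biasSlope θ + θ / 144) * n ∧
      (2 : ℝ) ^ (-(δ * n)) ≤ exCDFc n ((2 / biasSlope θ + θ / 144) * n) := by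
    refine ⟨by positivity, ?_⟩
    rw [two_rpow_neg_eq_exp, ← mul_assoc, ← hδ']
    rwa [hθ, sub_add_cancel] at hc
  refine ⟨⟨_, hmem⟩, ?_⟩
  have hτ : taudelta n δ ≤ (2 / biasSlope θ + θ / 144) * n := csInf_le ⟨0, fun t ht => ht.1⟩ hmem
  have ht : (4 / biasSlope θ + θ / 36) * n ≤ tdelta n δ := by
    have hd : (2 : ℝ) ^ (-(δ * n)) ≤ exCDFd n (tdelta n δ) :=
      Nat.sInf_mem (s := {t : ℕ | (2 : ℝ) ^ (-(δ * n)) ≤ exCDFd n t}) ⟨t₁, ht₁⟩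
    have key := two_mul_le_of_two_rpow_le_exCDFd hn hθ0.le hd
    refine le_of_mul_le_mul_right
      (le_trans (b := (2 * biasRate θ / biasSlope θ - 2 * ξ) * n) ?_ ?_)
      (show 0 < Real.log (1 + biasRate θ / 2) by linarith)
    · have := mul_le_mul_of_nonneg_right hrate hn0
      linarith
    · unfold biasDecay at hθ
      have e : 2 * θ = 2 * biasRate θ / biasSlope θ + (δ' - ξ) := by linarith
      rw [e, ← mul_assoc, ← hδ'] at key
      linarith
  have e : 4 / biasSlope θ = 2 * (2 / biasSlope θ) := by ring
  rw [e] at ht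
  have := mul_le_mul_of_nonneg_right hsqrt hn0
  linarith

/-- **Eq. (3.3).** Uniformly in `δ ∈ (0,1/2)`, `(t_δ - 2τ_δ)/(√δ n) = Θ(1)`;
in particular `2τ_δ < t_δ` for all sufficiently large `n`. -/
theorem tdelta_minus_two_taudelta :
    ∃ c C : ℝ, 0 < c ∧ 0 < C ∧
      ∀ δ : ℝ, 0 < δ → δ < 1/2 →
        ∃ n₀ : ℕ, ∀ n : ℕ, n₀ ≤ n →
          (c * Real.sqrt δ * n ≤ (tdelta n δ : ℝ) - 2 * taudelta n δ ∧
            (tdelta n δ : ℝ) - 2 * taudelta n δ ≤ C * Real.sqrt δ * n) ∧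
          2 * taudelta n δ < (tdelta n δ : ℝ) := by
  refine ⟨1 / 504, 50, by norm_num, by norm_num, fun δ h0 h1 => ?_⟩
  obtain ⟨n₀, h⟩ := eventually_atTop.1 ((eventually_le_tdelta_sub h0 h1).and
    ((eventually_tdelta_sub_le h0 (by linarith)).and (eventually_ge_atTop 1)))
  refine ⟨n₀, fun n hn => ?_⟩
  obtain ⟨⟨hne, hle⟩, hub, hn1⟩ := h n hn
  have hpos : 0 < 1 / 504 * √δ * n := by positivity
  exact ⟨⟨hle, hub hne⟩, by linarith⟩

end
end

section
/- For n ≥ 1 let X_n be a Poisson random variable with mean n and Y_n a Binomial(2n, 1/2) random variable. For δ ∈ (0,1/2) define t₁ = t₁(n,δ) := min{t ∈ ℕ : P[X_n ≤ t] ≥ 2^{−δn}} and t₂ = t₂(n,δ) := min{t ∈ ℕ : P[Y_n ≤ t] ≥ 2^{−δn}}. Then there exist absolute constants c, C > 0 such that for every δ ∈ (0,1/2) and all sufficiently large n: c·√δ·n ≤ n − t₁ ≤ C·√δ·n, c·√δ·n ≤ n − t₂ ≤ C·√δ·n, and c·√δ·n ≤ t₂ − t₁ ≤ C·√δ·n.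 -/
noncomputable section

/-- `P[X ≤ t]` for `X` Poisson with mean `n` -/
def poisCDF (n : ℕ) (t : ℕ) : ℝ :=
  ∑ k ∈ Finset.range (t+1), Real.exp (-(n : ℝ)) * (n : ℝ) ^ k / (Nat.factorial k : ℝ)

/-- `P[Y ≤ t]` for `Y` Binomial `(2n, 1/2)` -/
def binCDF (n : ℕ) (t : ℕ) : ℝ :=
  ∑ k ∈ Finset.range (t+1), (Nat.choose (2*n) k : ℝ) / 2 ^ (2*n)

/-- `t₁(n,δ) = min {t : P[X_n ≤ t] ≥ 2^{-δn}}` -/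
def t1 (n : ℕ) (δ : ℝ) : ℕ := sInf {t : ℕ | (2 : ℝ) ^ (-(δ * n)) ≤ poisCDF n t}

/-- `t₂(n,δ) = min {t : P[Y_n ≤ t] ≥ 2^{-δn}}` -/
def t2 (n : ℕ) (δ : ℝ) : ℕ := sInf {t : ℕ | (2 : ℝ) ^ (-(δ * n)) ≤ binCDF n t}

open Finset in
theorem poisCDF_le_exp {n t : ℕ} (hn : 0 < n) (ht : t ≤ n) :
    poisCDF n t ≤ Real.exp (-((n - t : ℝ) ^ 2 / (2 * n))) := by
  have hn' : (0 : ℝ) < n := by exact_mod_cast hn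
  have ht' : (t : ℝ) ≤ n := by exact_mod_cast ht
  obtain ⟨s, hs⟩ : ∃ s : ℝ, s = (n - t) / n := ⟨_, rfl⟩
  have hs0 : 0 ≤ s := hs ▸ div_nonneg (by linarith) hn'.le
  have hsn : s * n = n - t := by rw [hs]; field_simp
  have hexp : Real.exp (-s) ≤ 1 - s + s ^ 2 / 2 := by
    have h := Real.quadratic_le_exp_of_nonneg hs0
    have h1 : Real.exp s * Real.exp (-s) = 1 := by rw [← Real.exp_add]; simp
    have h2 : 0 ≤ 1 - s + s ^ 2 / 2 := by nlinarith [sq_nonneg (s - 1)]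
    refine le_of_mul_le_mul_left ?_ (Real.exp_pos s)
    rw [h1]
    calc (1 : ℝ) ≤ (1 + s + s ^ 2 / 2) * (1 - s + s ^ 2 / 2) := by
          nlinarith [sq_nonneg (s ^ 2)]
      _ ≤ _ := mul_le_mul_of_nonneg_right h h2
  calc poisCDF n t
      ≤ ∑ k ∈ range (t + 1), Real.exp (-(n : ℝ) + s * t) *
          ((n * Real.exp (-s)) ^ k / (k.factorial : ℝ)) := by
        refine sum_le_sum fun k hk => ?_
        have hk' : (k : ℝ) ≤ t := by exact_mod_cast Nat.lt_succ_iff.mp (mem_range.mp hk)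
        have h1 : 1 ≤ Real.exp (s * (t - k)) :=
          Real.one_le_exp (mul_nonneg hs0 (by linarith))
        have h2 : Real.exp (-(n : ℝ) + s * t) * ((n * Real.exp (-s)) ^ k / (k.factorial : ℝ)) =
            Real.exp (-(n : ℝ)) * (n : ℝ) ^ k / (k.factorial : ℝ) * Real.exp (s * (t - k)) := by
          rw [mul_pow, ← Real.exp_nat_mul, show s * (t - k) = s * t + k * -s by ring,
            Real.exp_add, Real.exp_add]
          ring
        rw [h2]
        exact le_mul_of_one_le_right (by positivity) h1
    _ ≤ Real.exp (-(n : ℝ) + s * t) * Real.exp (n * Real.exp (-s)) := by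
        rw [← mul_sum]
        gcongr
        exact Real.sum_le_exp_of_nonneg (by positivity) _
    _ ≤ _ := by
        rw [← Real.exp_add, Real.exp_le_exp]
        have h3 : (n - t : ℝ) ^ 2 / (2 * n) = s ^ 2 * n / 2 := by rw [← hsn]; field_simp
        rw [h3, show (t : ℝ) = n - s * n by linarith]
        nlinarith [mul_le_mul_of_nonneg_left hexp hn'.le]

open Finset in
theorem binCDF_le_exp {n t : ℕ} (hn : 0 < n) (ht : t ≤ n) :
    binCDF n t ≤ Real.exp (-((n - t : ℝ) ^ 2 / n)) := by
  have hn' : (0 : ℝ) < n := by exact_mod_cast hn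
  have ht' : (t : ℝ) ≤ n := by exact_mod_cast ht
  obtain ⟨s, hs⟩ : ∃ s : ℝ, s = (n - t) / n := ⟨_, rfl⟩
  have hs0 : 0 ≤ s := hs ▸ div_nonneg (by linarith) hn'.le
  have hsn : s * n = n - t := by rw [hs]; field_simp
  have hcosh : (Real.exp (-(2 * s)) + 1) / 2 ≤ Real.exp (-s + s ^ 2 / 2) := by
    have h : (Real.exp (-(2 * s)) + 1) / 2 = Real.exp (-s) * Real.cosh s := by
      rw [Real.cosh_eq, show -(2 * s) = -s + -s by ring, Real.exp_add]
      have h1 : Real.exp (-s) * Real.exp s = 1 := by rw [← Real.exp_add]; simp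
      linear_combination (-1 / 2) * h1
    rw [h, Real.exp_add]
    gcongr
    exact Real.cosh_le_exp_half_sq s
  calc binCDF n t
      ≤ ∑ k ∈ range (t + 1), Real.exp (2 * s * t) / 2 ^ (2 * n) *
          (Real.exp (-(2 * s)) ^ k * 1 ^ (2 * n - k) * ((2 * n).choose k : ℝ)) := by
        refine sum_le_sum fun k hk => ?_
        have hk' : (k : ℝ) ≤ t := by exact_mod_cast Nat.lt_succ_iff.mp (mem_range.mp hk)
        have h1 : 1 ≤ Real.exp (2 * s * (t - k)) :=
          Real.one_le_exp (mul_nonneg (by linarith) (by linarith))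
        have h2 : Real.exp (2 * s * t) / 2 ^ (2 * n) *
            (Real.exp (-(2 * s)) ^ k * 1 ^ (2 * n - k) * ((2 * n).choose k : ℝ)) =
            ((2 * n).choose k : ℝ) / 2 ^ (2 * n) * Real.exp (2 * s * (t - k)) := by
          rw [← Real.exp_nat_mul, show 2 * s * (t - k) = 2 * s * t + k * -(2 * s) by ring,
            Real.exp_add, one_pow]
          ring
        rw [h2]
        exact le_mul_of_one_le_right (by positivity) h1
    _ ≤ ∑ k ∈ range (2 * n + 1), Real.exp (2 * s * t) / 2 ^ (2 * n) *
          (Real.exp (-(2 * s)) ^ k * 1 ^ (2 * n - k) * ((2 * n).choose k : ℝ)) := by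
        refine sum_le_sum_of_subset_of_nonneg ?_ fun _ _ _ => by positivity
        intro k hk
        simp only [mem_range] at hk ⊢
        omega
    _ = Real.exp (2 * s * t) * ((Real.exp (-(2 * s)) + 1) / 2) ^ (2 * n) := by
        rw [← mul_sum, ← add_pow, div_pow]
        ring
    _ ≤ Real.exp (2 * s * t) * Real.exp (-s + s ^ 2 / 2) ^ (2 * n) := by gcongr
    _ = _ := by
        rw [← Real.exp_nat_mul, ← Real.exp_add]
        congr 1
        have h3 : (n - t : ℝ) ^ 2 / n = s ^ 2 * n := by rw [← hsn]; field_simp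
        rw [h3, show (t : ℝ) = n - s * n by linarith]
        push_cast
        ring

theorem factorial_mul_exp_le {n : ℕ} (hn : 0 < n) :
    (n.factorial : ℝ) * Real.exp n ≤ 3 * n * (n : ℝ) ^ n := by
  obtain ⟨m, rfl⟩ : ∃ m, n = m + 1 := ⟨n - 1, by omega⟩
  have h := Stirling.log_stirlingSeq'_antitone (Nat.zero_le m)
  have h2 : Stirling.stirlingSeq (m + 1) ≤ Real.exp 1 / √2 := by
    rw [← Stirling.stirlingSeq_one]
    exact (Real.log_le_log_iff (Stirling.stirlingSeq'_pos m) (Stirling.stirlingSeq'_pos 0)).mp h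
  generalize m + 1 = n at *
  have hn' : (1 : ℝ) ≤ n := by exact_mod_cast hn
  unfold Stirling.stirlingSeq at h2
  rw [div_le_iff₀ (by positivity), Real.sqrt_mul (by norm_num), div_pow, ← Real.exp_nat_mul,
    mul_one] at h2
  have h3 : Real.exp 1 / √2 * (√2 * √(n : ℝ) * ((n : ℝ) ^ n / Real.exp n)) =
      Real.exp 1 * √(n : ℝ) * (n : ℝ) ^ n / Real.exp n := by
    field_simp
  rw [h3, le_div_iff₀ (Real.exp_pos _)] at h2
  refine h2.trans ?_
  have h4 : √(n : ℝ) ≤ n := by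
    rw [Real.sqrt_le_left (by linarith)]
    nlinarith
  have h5 : Real.exp 1 ≤ 3 := Real.exp_one_lt_d9.le.trans (by norm_num)
  gcongr

theorem exp_neg_mul_le_one_sub {y : ℝ} (h0 : 0 ≤ y) (h1 : y ≤ 5 / 8) :
    Real.exp (-(8 / 5 * y)) ≤ 1 - y := by
  have h := convexOn_exp.2 (Set.mem_univ 0) (Set.mem_univ (-1 : ℝ))
    (show 0 ≤ 1 - 8 / 5 * y by linarith) (show 0 ≤ 8 / 5 * y by linarith) (by ring)
  simp only [smul_eq_mul, mul_zero, zero_add, mul_neg, mul_one, Real.exp_zero] at h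
  nlinarith [Real.exp_neg_one_lt_d9]

/-- The Poisson weights `n ^ (n - k) / (n - k)!` decay at most like a Gaussian below the mean. -/
theorem exp_mul_le_pow_div_factorial {n : ℕ} (hn : 0 < n) (k : ℕ) (hk : (k : ℝ) ≤ 5 / 8 * n) :
    Real.exp (-(4 / 5 * k ^ 2 / n)) * ((n : ℝ) ^ n / (n.factorial : ℝ)) ≤
      (n : ℝ) ^ (n - k) / ((n - k).factorial : ℝ) := by
  have hn' : (0 : ℝ) < n := by exact_mod_cast hn
  induction k with
  | zero => simp
  | succ k ih =>
    push_cast at hk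
    have hkn : k + 1 ≤ n := by
      have : (k + 1 : ℝ) ≤ n := by linarith
      exact_mod_cast this
    obtain ⟨m, rfl⟩ : ∃ m, n = m + (k + 1) := ⟨n - (k + 1), by omega⟩
    have ih := ih (by linarith)
    rw [show m + (k + 1) - k = m + 1 by omega] at ih
    rw [show m + (k + 1) - (k + 1) = m by omega]
    generalize hN : m + (k + 1) = n at *
    have hy := exp_neg_mul_le_one_sub (y := k / n) (by positivity)
      (by rw [div_le_iff₀ hn']; linarith)
    have hm : (m + 1 : ℝ) = n - k := by rw [← hN]; push_cast; ring
    have hstep : (n : ℝ) ^ m / (m.factorial : ℝ) =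
        (n : ℝ) ^ (m + 1) / ((m + 1).factorial : ℝ) * (1 - k / n) := by
      rw [Nat.factorial_succ, pow_succ]
      push_cast
      rw [one_sub_div hn'.ne', ← hm]
      field_simp
    rw [hstep]
    have he : Real.exp (-(4 / 5 * (k + 1 : ℝ) ^ 2 / n)) ≤
        Real.exp (-(4 / 5 * k ^ 2 / n)) * Real.exp (-(8 / 5 * (k / n))) := by
      rw [← Real.exp_add, Real.exp_le_exp]
      have : -(4 / 5 * (k : ℝ) ^ 2 / n) + -(8 / 5 * (k / n)) - -(4 / 5 * (k + 1 : ℝ) ^ 2 / n) =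
          4 / 5 / n := by
        field_simp
        ring
      have h2 : (0 : ℝ) ≤ 4 / 5 / n := by positivity
      linarith
    push_cast
    calc _ ≤ Real.exp (-(4 / 5 * k ^ 2 / n)) * Real.exp (-(8 / 5 * (k / n))) *
            ((n : ℝ) ^ n / (n.factorial : ℝ)) := by gcongr
      _ = Real.exp (-(4 / 5 * k ^ 2 / n)) * ((n : ℝ) ^ n / (n.factorial : ℝ)) *
            Real.exp (-(8 / 5 * (k / n))) := by ring
      _ ≤ _ := by gcongr

/-- The central binomial row decays at most like a Gaussian away from the middle. -/
theorem exp_mul_le_choose {n : ℕ} (hn : 0 < n) (k : ℕ) (hk : (k : ℝ) ≤ n / 2) :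
    Real.exp (-(2 * k ^ 2 / n)) * (n.centralBinom : ℝ) ≤ ((2 * n).choose (n - k) : ℝ) := by
  have hn' : (0 : ℝ) < n := by exact_mod_cast hn
  induction k with
  | zero => simp [Nat.centralBinom]
  | succ k ih =>
    push_cast at hk
    have hkn : k + 1 ≤ n := by
      have : (k + 1 : ℝ) ≤ n := by linarith
      exact_mod_cast this
    obtain ⟨m, rfl⟩ : ∃ m, n = m + (k + 1) := ⟨n - (k + 1), by omega⟩
    have ih := ih (by linarith)
    rw [show m + (k + 1) - k = m + 1 by omega] at ih
    rw [show m + (k + 1) - (k + 1) = m by omega]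
    have hc := Nat.choose_succ_right_eq (2 * (m + (k + 1))) m
    rw [show 2 * (m + (k + 1)) - m = (m + (k + 1)) + (k + 1) by omega] at hc
    generalize hN : m + (k + 1) = n at *
    have hm : (m + 1 : ℝ) = n - k := by rw [← hN]; push_cast; ring
    have hcR : ((2 * n).choose (m + 1) : ℝ) * (n - k) = ((2 * n).choose m : ℝ) * (n + k + 1) := by
      rw [← hm, add_assoc (n : ℝ)]
      exact_mod_cast hc
    have hpos : (0 : ℝ) < n - k := by linarith
    have hstep : ((2 * n).choose m : ℝ) =
        ((2 * n).choose (m + 1) : ℝ) * ((n - k) / (n + k + 1)) := by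
      rw [mul_div_assoc', hcR]
      field_simp
    have hratio : Real.exp (-(2 * (2 * k + 1) / n)) ≤ (n - k : ℝ) / (n + k + 1) := by
      rw [Real.exp_neg, ← inv_div (n + k + 1 : ℝ)]
      refine inv_anti₀ (by positivity) ?_
      have h1 := Real.add_one_le_exp (2 * (2 * k + 1) / n : ℝ)
      refine le_trans ?_ h1
      have h2 : (n + k + 1 : ℝ) / (n - k) = (2 * k + 1) / (n - k) + 1 := by
        field_simp
        ring
      rw [h2]
      gcongr ?_ + 1
      rw [div_le_div_iff₀ hpos hn']
      nlinarith
    rw [hstep]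
    have he : Real.exp (-(2 * (k + 1 : ℝ) ^ 2 / n)) =
        Real.exp (-(2 * k ^ 2 / n)) * Real.exp (-(2 * (2 * k + 1) / n)) := by
      rw [← Real.exp_add]
      congr 1
      field_simp
      ring
    push_cast
    calc _ = Real.exp (-(2 * k ^ 2 / n)) * (n.centralBinom : ℝ) *
            Real.exp (-(2 * (2 * k + 1) / n)) := by rw [he]; ring
      _ ≤ _ := by gcongr

theorem exp_div_le_poisCDF {n : ℕ} (hn : 0 < n) (k : ℕ) (hk : (k : ℝ) ≤ 5 / 8 * n) :
    Real.exp (-(4 / 5 * k ^ 2 / n)) / (3 * n) ≤ poisCDF n (n - k) := by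
  have hn' : (0 : ℝ) < n := by exact_mod_cast hn
  have h1 := exp_mul_le_pow_div_factorial hn k hk
  have h2 := factorial_mul_exp_le hn
  have h3 : Real.exp (-(n : ℝ)) * (n : ℝ) ^ (n - k) / ((n - k).factorial : ℝ) ≤
      poisCDF n (n - k) :=
    Finset.single_le_sum (f := fun k => Real.exp (-(n : ℝ)) * (n : ℝ) ^ k / (k.factorial : ℝ))
      (fun _ _ => by positivity) (Finset.self_mem_range_succ (n - k))
  refine le_trans ?_ h3
  rw [mul_div_assoc (Real.exp (-(n : ℝ)))]
  refine le_trans ?_ (mul_le_mul_of_nonneg_left h1 (Real.exp_pos _).le)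
  have h4 : 1 / (3 * n) ≤ Real.exp (-(n : ℝ)) * ((n : ℝ) ^ n / (n.factorial : ℝ)) := by
    rw [Real.exp_neg, inv_mul_eq_div, div_div, div_le_div_iff₀ (by positivity) (by positivity)]
    linarith
  calc _ = Real.exp (-(4 / 5 * k ^ 2 / n)) * (1 / (3 * n)) := by ring
    _ ≤ Real.exp (-(4 / 5 * k ^ 2 / n)) *
        (Real.exp (-(n : ℝ)) * ((n : ℝ) ^ n / (n.factorial : ℝ))) := by gcongr
    _ = _ := by ring

theorem exp_div_le_binCDF {n : ℕ} (hn : 0 < n) (k : ℕ) (hk : (k : ℝ) ≤ n / 2) :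
    Real.exp (-(2 * k ^ 2 / n)) / (3 * n) ≤ binCDF n (n - k) := by
  have hn' : (0 : ℝ) < n := by exact_mod_cast hn
  have h1 := exp_mul_le_choose hn k hk
  have h2 : (2 ^ (2 * n) : ℝ) ≤ 2 * n * n.centralBinom := by
    have := Nat.four_pow_le_two_mul_self_mul_centralBinom n hn
    rw [pow_mul]
    norm_num
    exact_mod_cast this
  have h3 : ((2 * n).choose (n - k) : ℝ) / 2 ^ (2 * n) ≤ binCDF n (n - k) :=
    Finset.single_le_sum (f := fun k => ((2 * n).choose k : ℝ) / 2 ^ (2 * n))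
      (fun _ _ => by positivity) (Finset.self_mem_range_succ (n - k))
  refine le_trans ?_ h3
  have h4 : 1 / (3 * n) ≤ (n.centralBinom : ℝ) / 2 ^ (2 * n) := by
    rw [div_le_div_iff₀ (by positivity) (by positivity)]
    have : (0 : ℝ) ≤ n * n.centralBinom := by positivity
    linarith
  calc _ = Real.exp (-(2 * k ^ 2 / n)) * (1 / (3 * n)) := by ring
    _ ≤ Real.exp (-(2 * k ^ 2 / n)) * ((n.centralBinom : ℝ) / 2 ^ (2 * n)) := by gcongr
    _ = Real.exp (-(2 * k ^ 2 / n)) * (n.centralBinom : ℝ) / 2 ^ (2 * n) := by ring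
    _ ≤ _ := by gcongr

theorem two_rpow_neg_le_exp_div {n : ℕ} {δ q : ℝ} (hδ : 0 < δ) (hn : 0 < n)
    (hnδ : 1000 ≤ δ ^ 2 * n) (hq : q ≤ 3 / 5 * (δ * n)) :
    (2 : ℝ) ^ (-(δ * n)) ≤ Real.exp (-q) / (3 * n) := by
  have hn' : (0 : ℝ) < n := by exact_mod_cast hn
  have hy : 0 ≤ 9 / 100 * (δ * n) := by positivity
  have h1 := Real.quadratic_le_exp_of_nonneg hy
  have h2 : 3 * n ≤ Real.exp (9 / 100 * (δ * n)) := by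
    refine le_trans ?_ h1
    nlinarith [mul_le_mul_of_nonneg_right hnδ hn'.le]
  rw [le_div_iff₀ (by positivity), Real.rpow_def_of_pos two_pos]
  calc _ ≤ Real.exp (Real.log 2 * -(δ * n)) * Real.exp (9 / 100 * (δ * n)) := by gcongr
    _ ≤ _ := by
      rw [← Real.exp_add, Real.exp_le_exp]
      have : 0 < δ * n := by positivity
      nlinarith [Real.log_two_gt_d9]

/-- Two-sided bounds on the quantile `sInf {t | 2 ^ (-(δ n)) ≤ F t}` of a function `F` with
Gaussian-type upper and lower bounds below `n`. -/
theorem sInf_quantile_bounds {n : ℕ} {δ a b B : ℝ} {F : ℕ → ℝ} (hδ : 0 < δ) (hδ' : δ < 1 / 2)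
    (hn : 0 < n) (hnδ : 1000 ≤ δ ^ 2 * n) (ha : 0 ≤ a) (hb : 0 < b) (hB : 0 ≤ B)
    (hbB : Real.log 2 * b ≤ B ^ 2)
    (hupper : ∀ t ≤ n, F t ≤ Real.exp (-((n - t : ℝ) ^ 2 / (b * n))))
    {p r : ℝ} (hp : 0 ≤ p) (hpa : p * a ^ 2 ≤ 3 / 5) (har : a * (5 / 7) ≤ r) (hr : r ≤ 1)
    (hlower : ∀ k : ℕ, (k : ℝ) ≤ r * n → Real.exp (-(p * k ^ 2 / n)) / (3 * n) ≤ F (n - k)) :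
    (a - 1 / 200) * √δ * n ≤ (n : ℝ) - (sInf {t : ℕ | (2 : ℝ) ^ (-(δ * n)) ≤ F t} : ℕ) ∧
      (n : ℝ) - (sInf {t : ℕ | (2 : ℝ) ^ (-(δ * n)) ≤ F t} : ℕ) ≤ B * √δ * n := by
  have hn' : (0 : ℝ) < n := by exact_mod_cast hn
  have hs0 : 0 ≤ √δ := Real.sqrt_nonneg _
  have hss : √δ ^ 2 = δ := Real.sq_sqrt hδ.le
  have hs : √δ ≤ 5 / 7 := by
    rw [Real.sqrt_le_left (by norm_num)]
    linarith
  obtain ⟨k, hk⟩ : ∃ k : ℕ, k = ⌊a * √δ * n⌋₊ := ⟨_, rfl⟩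
  have hk1 : (k : ℝ) ≤ a * √δ * n := hk ▸ Nat.floor_le (by positivity)
  have hk2 : a * √δ * n < k + 1 := hk ▸ Nat.lt_floor_add_one _
  have hkr : (k : ℝ) ≤ r * n := by
    refine hk1.trans ?_
    gcongr
    exact (mul_le_mul_of_nonneg_left hs ha).trans har
  have hkn : k ≤ n := by
    have : (k : ℝ) ≤ n := by nlinarith
    exact_mod_cast this
  have hmem : n - k ∈ {t : ℕ | (2 : ℝ) ^ (-(δ * n)) ≤ F t} := by
    refine (two_rpow_neg_le_exp_div hδ hn hnδ ?_).trans (hlower k hkr)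
    rw [div_le_iff₀ hn']
    calc p * (k : ℝ) ^ 2 ≤ p * (a * √δ * n) ^ 2 := by gcongr
      _ = p * a ^ 2 * (δ * n * n) := by rw [mul_pow, mul_pow, hss]; ring
      _ ≤ 3 / 5 * (δ * n * n) := by gcongr
      _ = _ := by ring
  have hle := Nat.sInf_le hmem
  have hT := Nat.sInf_mem ⟨_, hmem⟩
  generalize sInf {t : ℕ | (2 : ℝ) ^ (-(δ * n)) ≤ F t} = T at *
  have hTn : T ≤ n := hle.trans (Nat.sub_le _ _)
  have hTk : (T : ℝ) ≤ n - k := by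
    rw [← Nat.cast_sub hkn]
    exact_mod_cast hle
  constructor
  · have h1 : δ ≤ √δ := by nlinarith
    have h2 : 200 ≤ √δ * n := by
      have : δ ^ 2 * n ≤ δ * n := by nlinarith [mul_pos hδ hn']
      nlinarith
    nlinarith
  · have h1 : (2 : ℝ) ^ (-(δ * n)) ≤ Real.exp (-((n - T : ℝ) ^ 2 / (b * n))) :=
      hT.trans (hupper T hTn)
    rw [Real.rpow_def_of_pos two_pos, Real.exp_le_exp, mul_neg, neg_le_neg_iff,
      div_le_iff₀ (by positivity)] at h1
    refine abs_le_of_sq_le_sq' ?_ (by positivity) |>.2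
    calc (n - T : ℝ) ^ 2 ≤ Real.log 2 * b * (δ * n ^ 2) := by linarith
      _ ≤ B ^ 2 * (δ * n ^ 2) := by gcongr
      _ = _ := by rw [mul_pow, mul_pow, hss]; ring

/-- **Remark 3.4.** Uniformly in `δ ∈ (0,1/2)`: `n - t₁ = Θ(√δ n)`, `n - t₂ = Θ(√δ n)` and
`t₂ - t₁ = Θ(√δ n)`. -/
theorem poisson_vs_binomial_lower_deviations :
    ∃ c C : ℝ, 0 < c ∧ 0 < C ∧
      ∀ δ : ℝ, 0 < δ → δ < 1/2 →
        ∃ n₀ : ℕ, ∀ n : ℕ, n₀ ≤ n →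
          (c * Real.sqrt δ * n ≤ (n : ℝ) - (t1 n δ : ℝ) ∧
            (n : ℝ) - (t1 n δ : ℝ) ≤ C * Real.sqrt δ * n) ∧
          (c * Real.sqrt δ * n ≤ (n : ℝ) - (t2 n δ : ℝ) ∧
            (n : ℝ) - (t2 n δ : ℝ) ≤ C * Real.sqrt δ * n) ∧
          (c * Real.sqrt δ * n ≤ (t2 n δ : ℝ) - (t1 n δ : ℝ) ∧
            (t2 n δ : ℝ) - (t1 n δ : ℝ) ≤ C * Real.sqrt δ * n) := by
  refine ⟨1 / 100, 2, by norm_num, by norm_num, fun δ hδ hδ' => ⟨⌈1000 / δ ^ 2⌉₊ + 1, ?_⟩⟩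
  intro n hn
  have hn0 : 0 < n := by omega
  have hnδ : 1000 ≤ δ ^ 2 * n := by
    have h : 1000 / δ ^ 2 ≤ (n : ℝ) := (Nat.le_ceil _).trans (by exact_mod_cast (by omega))
    rw [div_le_iff₀ (by positivity)] at h
    linarith
  have hlog := Real.log_two_lt_d9
  have h1 := sInf_quantile_bounds (a := 43 / 50) (b := 2) (B := 6 / 5) (p := 4 / 5) (r := 5 / 8)
    hδ hδ' hn0 hnδ (by norm_num) (by norm_num) (by norm_num) (by linarith)
    (fun t ht => poisCDF_le_exp hn0 ht) (by norm_num) (by norm_num) (by norm_num) (by norm_num)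
    (fun k hk => exp_div_le_poisCDF hn0 k hk)
  have h2 := sInf_quantile_bounds (a := 1 / 2) (b := 1) (B := 167 / 200) (p := 2) (r := 1 / 2)
    hδ hδ' hn0 hnδ (by norm_num) (by norm_num) (by norm_num) (by linarith)
    (fun t ht => by simpa using binCDF_le_exp hn0 ht) (by norm_num) (by norm_num) (by norm_num)
    (by norm_num) (fun k hk => exp_div_le_binCDF hn0 k (by linarith))
  change _ ≤ (n : ℝ) - (t1 n δ : ℝ) ∧ (n : ℝ) - (t1 n δ : ℝ) ≤ _ at h1
  change _ ≤ (n : ℝ) - (t2 n δ : ℝ) ∧ (n : ℝ) - (t2 n δ : ℝ) ≤ _ at h2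
  have hpos : 0 ≤ √δ * n := by positivity
  refine ⟨⟨?_, ?_⟩, ⟨?_, ?_⟩, ?_, ?_⟩ <;> linarith
end
end
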